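/- There is an absolute constant C > 0 with the following property. Let p be a prime with log log p > 0, let A ⊆ F_p be a nonempty set with |A + A| ≤ K·|A| for some real K ≥ 1, and suppose that 3A − 2A ⊆ R (where 3A − 2A = A + A + A − A − A). Then |A| ≤ C · p^{13/40} · exp(C·(log K)²·(log log p)³). -/

import Mathlib

open Finset Pointwise

/-- The set of nonzero quadratic residues in `F_p`. -/
def quadRes (p : ℕ) [Fact p.Prime] : Finset (ZMod p) :=
  Finset.univ.filter fun x => ∃ y : ZMod p, y ≠ 0 ∧ y ^ 2 = x

section Stepanov

open Polynomial

variable {F : Type*} [Field F]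

/-- The operator `D` with `(f ^ e * r)^{(k)} = f ^ (e - k) * D r` for `k ≤ e`. -/
noncomputable def twistedDeriv (f : F[X]) (e : ℕ) : ℕ → F[X] →ₗ[F] F[X]
  | 0 => LinearMap.id
  | k + 1 => LinearMap.mulLeft F (((e - k : ℕ) : F[X]) * derivative f) ∘ₗ twistedDeriv f e k +
      LinearMap.mulLeft F f ∘ₗ derivative ∘ₗ twistedDeriv f e k

lemma iterate_derivative_pow_mul (f : F[X]) (e : ℕ) (r g : F[X]) (hg : derivative g = 0) (k : ℕ)
    (hk : k ≤ e) :
    derivative^[k] (f ^ e * r * g) = f ^ (e - k) * twistedDeriv f e k r * g := by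
  induction k with
  | zero => simp [twistedDeriv]
  | succ k ih =>
    rw [Function.iterate_succ_apply', ih (by omega)]
    obtain ⟨n, hn⟩ : ∃ n, e - k = n + 1 := ⟨e - k - 1, by omega⟩
    have hn' : e - (k + 1) = n := by omega
    simp only [twistedDeriv, hn, hn', LinearMap.add_apply, LinearMap.comp_apply,
      LinearMap.mulLeft_apply, derivative_mul, hg, derivative_pow, Nat.add_sub_cancel]
    simp only [map_natCast]
    ring

lemma natDegree_twistedDeriv_le (f : F[X]) (e k : ℕ) (r : F[X]) :
    (twistedDeriv f e k r).natDegree ≤ r.natDegree + k * f.natDegree := by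
  induction k with
  | zero => simp [twistedDeriv]
  | succ k ih =>
    simp only [twistedDeriv, LinearMap.add_apply, LinearMap.comp_apply, LinearMap.mulLeft_apply]
    refine (natDegree_add_le _ _).trans (max_le ?_ ?_)
    · refine natDegree_mul_le.trans ?_
      have h1 : (((e - k : ℕ) : F[X]) * derivative f).natDegree ≤ f.natDegree := by
        refine natDegree_mul_le.trans ?_
        have := natDegree_derivative_le f
        simp; omega
      nlinarith
    · refine natDegree_mul_le.trans ?_
      have h1 := natDegree_derivative_le (twistedDeriv f e k r)
      have h2 : (derivative (twistedDeriv f e k r)).natDegree ≤ r.natDegree + k * f.natDegree := by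
        omega
      nlinarith

lemma eq_zero_of_mul_sq_eq {f r s : F[X]} {c : F} (hc : c ≠ 0)
    (hf : ∃ x, Odd (f.rootMultiplicity x)) (h : f * r ^ 2 = C c * s ^ 2) : r = 0 ∧ s = 0 := by
  obtain ⟨x, hx⟩ := hf
  have hf0 : f ≠ 0 := by rintro rfl; simp at hx
  have hc' : (C c : F[X]) ≠ 0 := by simpa using hc
  have hr : r = 0 := by
    by_contra hr
    have hs : s ≠ 0 := by
      rintro rfl
      simp [hf0, hr] at h
    have h1 := congrArg (rootMultiplicity x) h
    rw [sq, sq, rootMultiplicity_mul (mul_ne_zero hf0 (mul_ne_zero hr hr)),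
      rootMultiplicity_mul (mul_ne_zero hr hr), rootMultiplicity_mul
      (mul_ne_zero hc' (mul_ne_zero hs hs)), rootMultiplicity_mul (mul_ne_zero hs hs),
      rootMultiplicity_C] at h1
    rcases hx with ⟨k, hk⟩
    omega
  subst hr
  simpa [hc'] using h.symm

lemma derivative_X_pow_mul_char (p : ℕ) [CharP F p] (j : ℕ) :
    derivative ((X : F[X]) ^ (j * p)) = 0 := by
  simp [derivative_X_pow]

variable {p : ℕ} [Fact p.Prime]

lemma natDegree_lt_of_degree_lt' {g : F[X]} {c : ℕ} (h : g.degree < c) (hc : 0 < c) :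
    g.natDegree < c := by
  by_cases hg : g = 0
  · simpa [hg] using hc
  · exact (natDegree_lt_iff_degree_lt hg).2 h

lemma stepanov_independence (hp : p ≠ 2) {f : (ZMod p)[X]} {c : ℕ} (h0 : f.coeff 0 ≠ 0)
    (hf : ∃ x, Odd (f.rootMultiplicity x)) (hc : f.natDegree + 2 * c ≤ p + 1) (B : ℕ) :
    ∀ (r s : ℕ → (ZMod p)[X]), (∀ j, r j ∈ degreeLT (ZMod p) c) →
      (∀ j, s j ∈ degreeLT (ZMod p) c) →
      ∑ j ∈ range B, r j * X ^ (j * p) +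
        f ^ ((p - 1) / 2) * ∑ j ∈ range B, s j * X ^ (j * p) = 0 →
      ∀ j < B, r j = 0 ∧ s j = 0 := by
  have hpp : p.Prime := Fact.out
  induction B with
  | zero => simp
  | succ B ih =>
    intro r s hr hs h
    have hodd : 2 * ((p - 1) / 2) + 1 = p := by
      have := hpp.odd_of_ne_two hp
      rcases this with ⟨k, hk⟩; omega
    have hsplit : ∀ r : ℕ → (ZMod p)[X], ∑ j ∈ range (B + 1), r j * X ^ (j * p) =
        r 0 + X ^ p * ∑ j ∈ range B, r (j + 1) * X ^ (j * p) := by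
      intro r
      rw [Finset.sum_range_succ', Finset.mul_sum, add_comm]
      congr 1
      · simp
      · refine Finset.sum_congr rfl fun j _ => ?_
        rw [add_mul, one_mul, pow_add]; ring
    rw [hsplit r, hsplit s] at h
    set R := ∑ j ∈ range B, r (j + 1) * X ^ (j * p)
    set T := ∑ j ∈ range B, s (j + 1) * X ^ (j * p)
    have hfp : f ^ p = f ^ ((p - 1) / 2) * f ^ ((p - 1) / 2) * f := by
      rw [← pow_add, ← pow_succ]; congr 1; omega
    have hdvd : X ^ p ∣ f ^ p - C (f.coeff 0) := by
      refine ⟨f.divX ^ p, ?_⟩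
      have := congrArg (expand (ZMod p) p) (divX_mul_X_add f)
      rw [map_add, map_mul, expand_X, expand_C, ZMod.expand_card, ZMod.expand_card] at this
      rw [← this]
      ring
    obtain ⟨w, hw⟩ := hdvd
    have key : X ^ p ∣ f * r 0 ^ 2 - C (f.coeff 0) * s 0 ^ 2 := by
      have e1 : r 0 = -(f ^ ((p - 1) / 2) * (s 0 + X ^ p * T)) - X ^ p * R := by
        linear_combination h
      have e2 : C (f.coeff 0) = f ^ p - X ^ p * w := by linear_combination -hw
      rw [e2, e1, hfp]
      exact ⟨f * (2 * (f ^ ((p - 1) / 2) * (s 0 + X ^ p * T)) * R + X ^ p * R ^ 2)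
        + f ^ ((p - 1) / 2) * f ^ ((p - 1) / 2) * f * (2 * s 0 * T + X ^ p * T ^ 2)
        + w * s 0 ^ 2, by ring⟩
    have hz : f * r 0 ^ 2 - C (f.coeff 0) * s 0 ^ 2 = 0 := by
      refine eq_zero_of_dvd_of_natDegree_lt key ?_
      rw [natDegree_X_pow]
      by_cases hc0 : c = 0
      · subst hc0
        have h1 := hr 0
        have h2 := hs 0
        rw [mem_degreeLT] at h1 h2
        have h1' : r 0 = 0 := by
          rw [← degree_eq_bot]; exact Nat.WithBot.lt_zero_iff.1 (by simpa using h1)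
        have h2' : s 0 = 0 := by
          rw [← degree_eq_bot]; exact Nat.WithBot.lt_zero_iff.1 (by simpa using h2)
        simp [h1', h2', hpp.pos]
      have hrd : (r 0).natDegree ≤ c - 1 := by
        have := hr 0
        rw [mem_degreeLT] at this
        exact Nat.le_pred_of_lt (natDegree_lt_of_degree_lt' this (Nat.pos_of_ne_zero hc0))
      have hsd : (s 0).natDegree ≤ c - 1 := by
        have := hs 0
        rw [mem_degreeLT] at this
        exact Nat.le_pred_of_lt (natDegree_lt_of_degree_lt' this (Nat.pos_of_ne_zero hc0))
      refine (natDegree_sub_le _ _).trans_lt (max_lt ?_ ?_)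
      · refine natDegree_mul_le.trans_lt ?_
        have := natDegree_pow_le (p := r 0) (n := 2)
        omega
      · refine (natDegree_C_mul_le _ _).trans_lt ?_
        have := natDegree_pow_le (p := s 0) (n := 2)
        omega
    obtain ⟨hr0, hs0⟩ := eq_zero_of_mul_sq_eq h0 hf (sub_eq_zero.1 hz)
    have hrest : R + f ^ ((p - 1) / 2) * T = 0 := by
      rw [hr0, hs0] at h
      have : X ^ p * (R + f ^ ((p - 1) / 2) * T) = 0 := by linear_combination h
      exact (mul_eq_zero.1 this).resolve_left (pow_ne_zero _ X_ne_zero)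
    have := ih (fun j => r (j + 1)) (fun j => s (j + 1)) (fun j => hr _) (fun j => hs _) hrest
    intro j hj
    rcases j with _ | j
    · exact ⟨hr0, hs0⟩
    · exact this j (by omega)

end Stepanov

section Stepanov

open Polynomial

variable {p : ℕ} [Fact p.Prime]

lemma exists_stepanov_coefficients (f : (ZMod p)[X]) (a : ZMod p) (q : ℕ) {c l B : ℕ}
    (h : l * (c + l * f.natDegree + B) < 2 * B * c) :
    ∃ r s : ℕ → (ZMod p)[X], (∀ j, r j ∈ degreeLT (ZMod p) c) ∧
      (∀ j, s j ∈ degreeLT (ZMod p) c) ∧ (∃ j < B, r j ≠ 0 ∨ s j ≠ 0) ∧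
      ∀ k < l, ∑ j ∈ range B, (twistedDeriv f l k (r j) +
        C a * twistedDeriv f (l + q) k (s j)) * X ^ j = 0 := by
  have hc : 0 < c := by
    rcases Nat.eq_zero_or_pos c with rfl | hc
    · simp at h
    · exact hc
  set Q := c + l * f.natDegree + B with hQ
  let V := (Fin B → degreeLT (ZMod p) c) × (Fin B → degreeLT (ZMod p) c)
  let L : ℕ → V →ₗ[ZMod p] (ZMod p)[X] := fun k => ∑ j : Fin B,
    LinearMap.mulRight (ZMod p) (X ^ (j : ℕ)) ∘ₗ
      (twistedDeriv f l k ∘ₗ Submodule.subtype _ ∘ₗ LinearMap.proj j ∘ₗ LinearMap.fst _ _ _ +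
        LinearMap.mulLeft (ZMod p) (C a) ∘ₗ twistedDeriv f (l + q) k ∘ₗ Submodule.subtype _ ∘ₗ
          LinearMap.proj j ∘ₗ LinearMap.snd _ _ _)
  let Φ : V →ₗ[ZMod p] (Fin l → Fin Q → ZMod p) :=
    LinearMap.pi fun k => LinearMap.pi fun i => lcoeff (ZMod p) i ∘ₗ L k
  have hfin : Module.finrank (ZMod p) (degreeLT (ZMod p) c) = c := by
    rw [(degreeLTEquiv (ZMod p) c).finrank_eq]; simp
  have hker : LinearMap.ker Φ ≠ ⊥ := by
    refine LinearMap.ker_ne_bot_of_finrank_lt ?_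
    simp only [V, Module.finrank_prod, Module.finrank_pi_fintype, hfin, Finset.sum_const,
      Finset.card_univ, Fintype.card_fin, smul_eq_mul, Module.finrank_self, mul_one]
    linarith
  obtain ⟨v, hv, hv0⟩ := Submodule.exists_mem_ne_zero_of_ne_bot hker
  let r : ℕ → (ZMod p)[X] := fun j => if h : j < B then (v.1 ⟨j, h⟩ : (ZMod p)[X]) else 0
  let s : ℕ → (ZMod p)[X] := fun j => if h : j < B then (v.2 ⟨j, h⟩ : (ZMod p)[X]) else 0
  have hr : ∀ j, r j ∈ degreeLT (ZMod p) c := by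
    intro j
    by_cases hj : j < B
    · simp only [r, hj, dite_true, SetLike.coe_mem]
    · simp [r, hj]
  have hs : ∀ j, s j ∈ degreeLT (ZMod p) c := by
    intro j
    by_cases hj : j < B
    · simp only [s, hj, dite_true, SetLike.coe_mem]
    · simp [s, hj]
  refine ⟨r, s, hr, hs, ?_, ?_⟩
  · by_contra! hcon
    refine hv0 (Prod.ext ?_ ?_)
    · funext j
      have := (hcon j j.2).1
      simp only [r, j.2, dite_true] at this
      exact Subtype.ext this
    · funext j
      have := (hcon j j.2).2
      simp only [s, j.2, dite_true] at this
      exact Subtype.ext this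
  · intro k hk
    have hL : L k v = ∑ j ∈ range B, (twistedDeriv f l k (r j) +
        C a * twistedDeriv f (l + q) k (s j)) * X ^ j := by
      rw [Finset.sum_range]
      simp [L, r, s]
      rfl
    rw [← hL]
    ext i
    rw [coeff_zero]
    by_cases hi : i < Q
    · have := congrFun (congrFun (LinearMap.mem_ker.1 hv) ⟨k, hk⟩) ⟨i, hi⟩
      simpa [Φ] using this
    · refine coeff_eq_zero_of_natDegree_lt (lt_of_le_of_lt (b := c - 1 + k * f.natDegree + B) ?_
        (Nat.lt_of_lt_of_le ?_ (not_lt.1 hi)))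
      · rw [hL]
        refine natDegree_sum_le_of_forall_le _ _ fun j hj => ?_
        have hj' := Finset.mem_range.1 hj
        refine natDegree_mul_le.trans ?_
        rw [natDegree_X_pow]
        refine add_le_add ?_ hj'.le
        have hd : ∀ g ∈ degreeLT (ZMod p) c, ∀ e,
            (twistedDeriv f e k g).natDegree ≤ c - 1 + k * f.natDegree := by
          intro g hg e
          have h1 := natDegree_twistedDeriv_le f e k g
          have h2 := natDegree_lt_of_degree_lt' (mem_degreeLT.1 hg) hc
          omega
        exact (natDegree_add_le _ _).trans (max_le (hd _ (hr j) _)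
          ((natDegree_C_mul_le _ _).trans (hd _ (hs j) _)))
      · have : k * f.natDegree ≤ l * f.natDegree := Nat.mul_le_mul_right _ hk.le
        omega

lemma stepanov_count (hp : p ≠ 2) {f : (ZMod p)[X]} (h0 : f.coeff 0 ≠ 0)
    (hf : ∃ x, Odd (f.rootMultiplicity x)) (a : ZMod p) {c l B : ℕ} (hl : 0 < l) (hlp : l ≤ p)
    (hc : f.natDegree + 2 * c ≤ p + 1)
    (h : l * (c + l * f.natDegree + B) < 2 * B * c) :
    l * #{t : ZMod p | f.eval t ^ ((p - 1) / 2) = a} + p ≤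
      (l + (p - 1) / 2) * f.natDegree + c + B * p := by
  classical
  have hpp : p.Prime := Fact.out
  set q := (p - 1) / 2
  obtain ⟨r, s, hr, hs, hne, hrs⟩ := exists_stepanov_coefficients f a q h
  have hB : 0 < B := by obtain ⟨j, hj, -⟩ := hne; omega
  have hc0 : 0 < c := by
    rcases Nat.eq_zero_or_pos c with rfl | hc
    · simp at h
    · exact hc
  have hf0 : f ≠ 0 := by rintro rfl; simp at h0
  set G : (ZMod p)[X] := ∑ j ∈ range B, (f ^ l * r j * X ^ (j * p) +
    f ^ (l + q) * s j * X ^ (j * p)) with hG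
  have hG0 : G ≠ 0 := by
    intro hG0
    have e : G = f ^ l * (∑ j ∈ range B, r j * X ^ (j * p) +
        f ^ q * ∑ j ∈ range B, s j * X ^ (j * p)) := by
      rw [hG, Finset.mul_sum, ← Finset.sum_add_distrib, Finset.mul_sum]
      exact Finset.sum_congr rfl fun j _ => by ring
    rw [e] at hG0
    have := stepanov_independence hp h0 hf hc B r s hr hs
      ((mul_eq_zero.1 hG0).resolve_left (pow_ne_zero _ hf0))
    obtain ⟨j, hj, hj'⟩ := hne
    rcases hj' with hj' | hj'
    · exact hj' (this j hj).1
    · exact hj' (this j hj).2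
  have hdeg : G.natDegree + p ≤ (l + q) * f.natDegree + c + B * p := by
    have : G.natDegree ≤ (l + q) * f.natDegree + (c - 1) + (B - 1) * p := by
      refine natDegree_sum_le_of_forall_le _ _ fun j hj => ?_
      have hj' := Finset.mem_range.1 hj
      have hterm : ∀ g ∈ degreeLT (ZMod p) c, ∀ e ≤ l + q, (f ^ e * g * X ^ (j * p)).natDegree ≤
          (l + q) * f.natDegree + (c - 1) + (B - 1) * p := by
        intro g hg e he
        have h2 := natDegree_lt_of_degree_lt' (mem_degreeLT.1 hg) hc0
        refine natDegree_mul_le.trans (add_le_add (natDegree_mul_le.trans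
          (add_le_add ?_ (by omega))) ?_)
        · exact natDegree_pow_le.trans (Nat.mul_le_mul_right _ he)
        · rw [natDegree_X_pow]
          exact Nat.mul_le_mul_right _ (by omega)
      exact (natDegree_add_le _ _).trans (max_le (hterm _ (hr j) _ (by omega))
        (hterm _ (hs j) _ le_rfl))
    have e : (B - 1) * p + p = B * p := by
      obtain ⟨b, rfl⟩ : ∃ b, B = b + 1 := ⟨B - 1, by omega⟩
      simp; ring
    omega
  have hmult : ∀ t : ZMod p, f.eval t ^ q = a → l ≤ G.rootMultiplicity t := by
    intro t ht
    obtain ⟨n, rfl⟩ : ∃ n, l = n + 1 := ⟨l - 1, by omega⟩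
    refine Nat.succ_le_of_lt (lt_rootMultiplicity_of_isRoot_iterate_derivative_of_mem_nonZeroDivisors
      hG0 (fun k hk => ?_) ?_)
    · rw [IsRoot.def, hG, iterate_derivative_sum]
      have hterm : ∀ j ∈ range B, (derivative^[k] (f ^ (n + 1) * r j * X ^ (j * p) +
          f ^ (n + 1 + q) * s j * X ^ (j * p))) = f ^ (n + 1 - k) *
          ((twistedDeriv f (n + 1) k (r j) + f ^ q * twistedDeriv f (n + 1 + q) k (s j)) *
            X ^ (j * p)) := by
        intro j _
        rw [iterate_map_add, iterate_derivative_pow_mul _ _ _ _ (derivative_X_pow_mul_char p j) _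
          (by omega), iterate_derivative_pow_mul _ _ _ _ (derivative_X_pow_mul_char p j) _
          (by omega), show n + 1 + q - k = n + 1 - k + q by omega, pow_add]
        ring
      rw [Finset.sum_congr rfl hterm, ← Finset.mul_sum, eval_mul, eval_finsetSum]
      have := congrArg (eval t) (hrs k (by omega))
      rw [eval_finsetSum, eval_zero] at this
      refine mul_eq_zero_of_right _ (Eq.trans (Finset.sum_congr rfl fun j _ => ?_) this)
      simp only [eval_mul, eval_add, eval_pow, eval_X, eval_C, ht]
      rw [mul_comm j p, pow_mul, ZMod.pow_card]
    · refine mem_nonZeroDivisors_of_ne_zero ?_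
      rw [Ne, ZMod.natCast_eq_zero_iff, hpp.dvd_factorial]
      omega
  have hcount : l * #{t : ZMod p | f.eval t ^ q = a} ≤ G.natDegree := by
    calc l * #{t : ZMod p | f.eval t ^ q = a}
        = ∑ t ∈ {t : ZMod p | f.eval t ^ q = a}, l := by simp [mul_comm]
      _ ≤ ∑ t ∈ {t : ZMod p | f.eval t ^ q = a}, G.roots.count t := by
          refine Finset.sum_le_sum fun t ht => ?_
          rw [count_roots]
          exact hmult t (by simpa using ht)
      _ ≤ ∑ t : ZMod p, G.roots.count t :=
          Finset.sum_le_sum_of_subset (Finset.subset_univ _)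
      _ = G.roots.card := Multiset.sum_count_eq_card (by simp)
      _ ≤ G.natDegree := card_roots' G
  omega

end Stepanov

section CharacterSums

open Polynomial

variable {p : ℕ} [Fact p.Prime]

lemma card_pow_eq_le (hp : 1000 ≤ p) {S : Finset (ZMod p)} (h0 : (0 : ZMod p) ∉ S)
    (hS : S.Nonempty) (a : ZMod p) :
    2 * #{t : ZMod p | (∏ y ∈ S, (t + y)) ^ ((p - 1) / 2) = a} ≤ p + 40 * (#S * Nat.sqrt p) := by
  classical
  set h := Nat.sqrt p with hh
  set m := #S with hm
  have hm0 : 0 < m := hS.card_pos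
  have h1 : h * h ≤ p := Nat.sqrt_le p
  have h2 : p ≤ h * h + h + h := Nat.sqrt_le_add p
  have h30 : 30 ≤ h := by
    by_contra! hcon
    nlinarith
  have hhp : h ≤ p := Nat.sqrt_le_self p
  rcases lt_or_ge h m with hhm | hhm
  · have : #{t : ZMod p | (∏ y ∈ S, (t + y)) ^ ((p - 1) / 2) = a} ≤ p := by
      simpa [ZMod.card] using Finset.card_le_univ
        ({t : ZMod p | (∏ y ∈ S, (t + y)) ^ ((p - 1) / 2) = a} : Finset (ZMod p))
    nlinarith
  set f : (ZMod p)[X] := ∏ y ∈ S, (X + C y) with hf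
  have hev : ∀ t, f.eval t = ∏ y ∈ S, (t + y) := by
    intro t; simp [hf, eval_prod]
  have hmonic : f.Monic := monic_prod_of_monic _ _ fun y _ => monic_X_add_C y
  have hdeg : f.natDegree = m := by
    rw [hf, natDegree_prod_of_monic _ _ fun y _ => monic_X_add_C y]; simp [hm]
  have hc0 : f.coeff 0 ≠ 0 := by
    rw [coeff_zero_eq_eval_zero, hev]
    refine Finset.prod_ne_zero_iff.2 fun y hy => ?_
    rw [zero_add]; rintro rfl; exact h0 hy
  have hroot : ∃ x, Odd (f.rootMultiplicity x) := by
    obtain ⟨y, hy⟩ := hS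
    refine ⟨-y, ?_⟩
    have e : f = (X - C (-y)) ^ 1 * ∏ z ∈ S.erase y, (X + C z) := by
      rw [hf, ← Finset.mul_prod_erase _ _ hy]; simp
    have : f.rootMultiplicity (-y) = 1 := by
      rw [e, rootMultiplicity_mul (e ▸ hmonic.ne_zero), rootMultiplicity_X_sub_C_pow,
        rootMultiplicity_eq_zero]
      rw [IsRoot.def, eval_prod, Finset.prod_eq_zero_iff]
      rintro ⟨z, hz, hz'⟩
      simp only [eval_add, eval_X, eval_C] at hz'
      exact (Finset.mem_erase.1 hz).1 (neg_add_eq_zero.1 hz').symm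
    rw [this]; exact odd_one
  have key := stepanov_count (p := p) (by omega) hc0 hroot a (c := (p + 1 - m) / 2) (l := 2 * h)
    (B := h + (8 * m + 8)) (by omega) (by nlinarith) (by omega) (by
      rw [hdeg]
      obtain ⟨c, hc⟩ : ∃ c, c = (p + 1 - m) / 2 := ⟨_, rfl⟩
      rw [← hc]
      have a1 : 2 * c + m ≤ p + 1 := by omega
      have a2 : p ≤ 2 * c + m := by omega
      have a3 : 6 * h ≤ p := by nlinarith
      have a4 : h * (2 * c) ≤ h * (p + 1 - m) := Nat.mul_le_mul_left _ (by omega)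
      zify [show m ≤ p + 1 by omega] at *
      nlinarith [mul_nonneg hm0.le (sub_nonneg.2 h1), mul_nonneg hm0.le (sub_nonneg.2 a2),
        mul_nonneg hm0.le (sub_nonneg.2 a3), mul_nonneg hm0.le (sub_nonneg.2 hhm)])
  simp only [hev, hdeg] at key
  set n := #{t : ZMod p | (∏ y ∈ S, (t + y)) ^ ((p - 1) / 2) = a}
  by_contra! hcon
  obtain ⟨c, hc⟩ : ∃ c, c = (p + 1 - m) / 2 := ⟨_, rfl⟩
  obtain ⟨q, hq⟩ : ∃ q, q = (p - 1) / 2 := ⟨_, rfl⟩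
  rw [← hc, ← hq] at key
  have b1 : 2 * c ≤ p := by omega
  have b2 : 2 * q ≤ p := by omega
  have b3 : h * (p + 40 * (m * h)) ≤ h * (2 * n) := Nat.mul_le_mul_left _ hcon.le
  have b4 : 2 * (m * q) ≤ m * p := by nlinarith
  have b5 : m * p ≤ m * (h * h + h + h) := Nat.mul_le_mul_left _ h2
  have b6 : 30 * (m * h) ≤ m * h * h := by nlinarith
  have b7 : p ≤ m * p := Nat.le_mul_of_pos_left _ hm0
  have b8 : 0 < m * h := by positivity
  nlinarith

lemma abs_sum_prod_quadraticChar_le (hp : 1000 ≤ p) {S : Finset (ZMod p)}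
    (h0 : (0 : ZMod p) ∉ S) (hS : S.Nonempty) :
    |∑ t : ZMod p, ∏ y ∈ S, quadraticChar (ZMod p) (t + y)| ≤ 41 * (#S * Nat.sqrt p : ℕ) := by
  classical
  have hpp : p.Prime := Fact.out
  have hp2 : ringChar (ZMod p) ≠ 2 := by rw [ZMod.ringChar_zmod_n]; omega
  have hq : Fintype.card (ZMod p) / 2 = (p - 1) / 2 := by
    rw [ZMod.card]
    rcases hpp.odd_of_ne_two (by omega) with ⟨k, hk⟩
    omega
  set g : ZMod p → ℤ := fun t => ∏ y ∈ S, quadraticChar (ZMod p) (t + y) with hg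
  have hg' : ∀ t, g t = quadraticChar (ZMod p) (∏ y ∈ S, (t + y)) := fun t => by
    rw [hg, map_prod]
  have hgv : ∀ t, g t = 0 ∨ g t = 1 ∨ g t = -1 := by
    intro t
    rw [hg']
    by_cases hz : ∏ y ∈ S, (t + y) = 0
    · left; rw [hz]; simp
    · exact Or.inr (quadraticChar_dichotomy hz)
  have hcast : ∀ t, ((g t : ℤ) : ZMod p) = (∏ y ∈ S, (t + y)) ^ ((p - 1) / 2) := by
    intro t
    rw [hg', quadraticChar_eq_pow_of_char_ne_two' hp2, hq]
  have hN : ∀ a : ℤ, 2 * #{t | g t = a} ≤ p + 40 * (#S * Nat.sqrt p) := by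
    intro a
    refine le_trans (Nat.mul_le_mul_left 2 (Finset.card_le_card fun t ht => ?_))
      (card_pow_eq_le hp h0 hS (a : ZMod p))
    simp only [Finset.mem_filter, Finset.mem_univ, true_and] at ht ⊢
    rw [← hcast, ht]
  have hzero : #{t | g t = 0} ≤ #S := by
    have : ({t | g t = 0} : Finset (ZMod p)) ⊆ S.image (fun y => -y) := by
      intro t ht
      simp only [Finset.mem_filter, Finset.mem_univ, true_and] at ht
      rw [hg', quadraticChar_eq_zero_iff, Finset.prod_eq_zero_iff] at ht
      obtain ⟨y, hy, hty⟩ := ht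
      exact Finset.mem_image.2 ⟨y, hy, (eq_neg_of_add_eq_zero_left hty).symm⟩
    exact (Finset.card_le_card this).trans Finset.card_image_le
  have htot : (#{t | g t = 0} : ℤ) + #{t | g t = 1} + #{t | g t = -1} = p := by
    have : ∀ t, (if g t = 0 then (1 : ℤ) else 0) + (if g t = 1 then 1 else 0) +
        (if g t = -1 then 1 else 0) = 1 := by
      intro t; rcases hgv t with h | h | h <;> simp [h]
    rw [Finset.card_filter, Finset.card_filter, Finset.card_filter]
    push_cast
    rw [← Finset.sum_add_distrib, ← Finset.sum_add_distrib, Finset.sum_congr rfl fun t _ => this t]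
    simp [ZMod.card]
  have hsum : ∑ t, g t = (#{t | g t = 1} : ℤ) - #{t | g t = -1} := by
    rw [Finset.card_filter, Finset.card_filter]
    push_cast
    rw [← Finset.sum_sub_distrib]
    refine Finset.sum_congr rfl fun t _ => ?_
    rcases hgv t with h | h | h <;> simp [h]
  rw [hsum]
  have n1 := hN 1
  have n2 := hN (-1)
  have n3 : #S ≤ #S * Nat.sqrt p :=
    Nat.le_mul_of_pos_right _ (Nat.sqrt_pos.2 hpp.pos)
  rw [abs_le]
  constructor <;> omega

lemma card_forall_quadraticChar_eq_le (hp : 1000 ≤ p) {Y : Finset (ZMod p)}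
    (h0 : (0 : ZMod p) ∉ Y) {σ : ℤ} (hσ : σ = 1 ∨ σ = -1) :
    2 ^ #Y * #{t : ZMod p | ∀ y ∈ Y, quadraticChar (ZMod p) (t + y) = σ} ≤
      p + 2 ^ #Y * (41 * (#Y * Nat.sqrt p)) := by
  classical
  set χ := quadraticChar (ZMod p)
  have hχ : ∀ x, χ x = 0 ∨ χ x = 1 ∨ χ x = -1 := by
    intro x
    by_cases hz : x = 0
    · left; rw [hz]; simp [χ]
    · exact Or.inr (quadraticChar_dichotomy hz)
  have hnn : ∀ t y, 0 ≤ 1 + σ * χ (t + y) := by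
    intro t y
    rcases hσ with rfl | rfl <;> rcases hχ (t + y) with h | h | h <;> simp [h]
  have h1 : (2 : ℤ) ^ #Y * #{t : ZMod p | ∀ y ∈ Y, χ (t + y) = σ} ≤
      ∑ t, ∏ y ∈ Y, (1 + σ * χ (t + y)) := by
    rw [mul_comm, ← nsmul_eq_mul, ← Finset.sum_const]
    refine le_trans (Finset.sum_le_sum fun t ht => ?_) (Finset.sum_le_sum_of_subset_of_nonneg
      (Finset.subset_univ {t : ZMod p | ∀ y ∈ Y, χ (t + y) = σ}) fun t _ _ =>
        Finset.prod_nonneg fun y _ => hnn t y)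
    simp only [Finset.mem_filter, Finset.mem_univ, true_and] at ht
    rw [← Finset.prod_const]
    refine Finset.prod_le_prod (fun _ _ => by norm_num) fun y hy => ?_
    rw [ht y hy]
    rcases hσ with rfl | rfl <;> norm_num
  have h2 : ∑ t, ∏ y ∈ Y, (1 + σ * χ (t + y)) =
      ∑ S ∈ Y.powerset, σ ^ #S * ∑ t, ∏ y ∈ S, χ (t + y) := by
    simp_rw [Finset.prod_one_add]
    rw [Finset.sum_comm]
    refine Finset.sum_congr rfl fun S _ => ?_
    rw [Finset.mul_sum]
    refine Finset.sum_congr rfl fun t _ => ?_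
    rw [Finset.prod_mul_distrib, Finset.prod_const]
  have h3 : ∑ S ∈ Y.powerset, σ ^ #S * ∑ t, ∏ y ∈ S, χ (t + y) ≤
      p + 2 ^ #Y * (41 * (#Y * Nat.sqrt p : ℕ)) := by
    rw [← Finset.add_sum_erase _ _ (Finset.empty_mem_powerset Y)]
    refine add_le_add (by simp [ZMod.card]) ?_
    refine (Finset.sum_le_card_nsmul _ _ (41 * (#Y * Nat.sqrt p : ℕ) : ℤ) fun S hS => ?_).trans ?_
    · rw [Finset.mem_erase, Finset.mem_powerset] at hS
      have hb := abs_sum_prod_quadraticChar_le hp (fun h => h0 (hS.2 h))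
        (Finset.nonempty_iff_ne_empty.2 hS.1)
      refine (le_abs_self _).trans ?_
      rw [abs_mul, abs_pow, show |σ| = 1 by rcases hσ with rfl | rfl <;> simp, one_pow, one_mul]
      refine hb.trans ?_
      have := Nat.mul_le_mul_right (Nat.sqrt p) (Finset.card_le_card hS.2)
      have : ((#S * Nat.sqrt p : ℕ) : ℤ) ≤ (#Y * Nat.sqrt p : ℕ) := by exact_mod_cast this
      linarith
    · rw [nsmul_eq_mul]
      refine mul_le_mul_of_nonneg_right ?_ (by positivity)
      have := (Finset.card_erase_le (s := Y.powerset) (a := ∅)).trans_eq (Finset.card_powerset Y)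
      exact_mod_cast this
  have := h1.trans (h2.trans_le h3)
  exact_mod_cast this

end CharacterSums

section ApproximateGroups

/-- `U` is a symmetric set containing `0` whose doubling is covered by at most `κ` translates. -/
structure IsApproxGroup {G : Type*} [AddCommGroup G] [DecidableEq G] (κ : ℕ) (U : Finset G) :
    Prop where
  zero_mem : (0 : G) ∈ U
  neg_mem : ∀ x ∈ U, -x ∈ U
  cover : ∃ F : Finset G, #F ≤ κ ∧ U + U ⊆ F + U

/-- The number of `x ∈ U` with `c * x ∈ U`. -/
def dilateCount {R : Type*} [Mul R] [DecidableEq R] (U : Finset R) (c : R) : ℕ :=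
  #{x ∈ U | c * x ∈ U}

lemma IsApproxGroup.card_triple_le {G : Type*} [AddCommGroup G] [DecidableEq G] {κ : ℕ}
    {U : Finset G} (hU : IsApproxGroup κ U) : #(U + (U - U)) ≤ κ ^ 2 * #U := by
  obtain ⟨F, hF, hcov⟩ := hU.cover
  have h1 : U - U ⊆ F + U := by
    refine subset_trans (fun x hx => ?_) hcov
    obtain ⟨a, ha, b, hb, rfl⟩ := Finset.mem_sub.1 hx
    rw [sub_eq_add_neg]
    exact Finset.add_mem_add ha (hU.neg_mem b hb)
  have h2 : U + (U - U) ⊆ (F + F) + U := by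
    calc U + (U - U) ⊆ U + (F + U) := Finset.add_subset_add_left h1
      _ = F + (U + U) := by abel
      _ ⊆ F + (F + U) := Finset.add_subset_add_left hcov
      _ = (F + F) + U := by abel
  calc #(U + (U - U)) ≤ #((F + F) + U) := Finset.card_le_card h2
    _ ≤ #(F + F) * #U := Finset.card_add_le
    _ ≤ (#F * #F) * #U := Nat.mul_le_mul_right _ Finset.card_add_le
    _ ≤ κ ^ 2 * #U := by rw [sq]; gcongr

variable {k : Type*} [Field k] [DecidableEq k]

lemma IsApproxGroup.add_smul {κ : ℕ} {U : Finset k} (hU : IsApproxGroup κ U) (ρ : k) :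
    IsApproxGroup (κ ^ 2) (U + ρ • U) := by
  obtain ⟨F, hF, hcov⟩ := hU.cover
  refine ⟨?_, ?_, F + ρ • F, ?_, ?_⟩
  · exact Finset.mem_add.2 ⟨0, hU.zero_mem, 0,
      Finset.mem_smul_finset.2 ⟨0, hU.zero_mem, by simp⟩, by simp⟩
  · intro x hx
    obtain ⟨a, ha, b, hb, rfl⟩ := Finset.mem_add.1 hx
    obtain ⟨c, hc, rfl⟩ := Finset.mem_smul_finset.1 hb
    exact Finset.mem_add.2 ⟨-a, hU.neg_mem a ha, ρ • (-c),
      Finset.smul_mem_smul_finset (hU.neg_mem c hc), by simp; ring⟩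
  · calc #(F + ρ • F) ≤ #F * #(ρ • F) := Finset.card_add_le
      _ ≤ κ * κ := Nat.mul_le_mul hF (Finset.card_image_le.trans hF)
      _ = κ ^ 2 := by ring
  · calc U + ρ • U + (U + ρ • U) = (U + U) + ρ • (U + U) := by
          rw [smul_add]; abel
      _ ⊆ (F + U) + ρ • (F + U) :=
          Finset.add_subset_add hcov (Finset.smul_finset_subset_smul_finset hcov)
      _ = F + ρ • F + (U + ρ • U) := by rw [smul_add]; abel

lemma sum_dilateCount_le (S W : Finset k) :
    ∑ c ∈ W, #{x ∈ S | x ≠ 0 ∧ c * x ∈ S} ≤ #S ^ 2 := by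
  rw [← Finset.card_sigma, sq, ← Finset.card_product]
  refine Finset.card_le_card_of_injOn (fun y => (y.2, y.1 * y.2)) ?_ ?_
  · intro y hy
    simp only [Finset.coe_sigma, Set.mem_sigma_iff, Finset.mem_coe, Finset.mem_filter] at hy
    exact Finset.mem_product.2 ⟨hy.2.1, hy.2.2.2⟩
  · rintro ⟨c, x⟩ hy ⟨c', x'⟩ hy' h
    simp only [Finset.coe_sigma, Set.mem_sigma_iff, Finset.mem_coe, Finset.mem_filter] at hy hy'
    simp only [Prod.mk.injEq] at h
    obtain ⟨rfl, h⟩ := h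
    have := mul_right_cancel₀ hy.2.2.1 h
    subst this
    rfl

lemma sq_dilateCount_le {ρ : k} (hρ : ρ ≠ 0) (U : Finset k) (c : k) :
    dilateCount U c ^ 2 ≤
      dilateCount ((U - U) ∩ ρ • (U - U)) c * dilateCount (U + ρ • U) c := by
  rw [sq]
  unfold dilateCount
  rw [← Finset.card_product]
  refine Finset.card_le_mul_card_image_of_maps_to (f := fun y : k × k => y.1 + ρ * y.2) ?_ _ ?_
  · rintro ⟨x, y⟩ hxy
    simp only [Finset.mem_product, Finset.mem_filter] at hxy ⊢
    refine ⟨Finset.add_mem_add hxy.1.1 (Finset.smul_mem_smul_finset hxy.2.1), ?_⟩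
    rw [show c * (x + ρ * y) = c * x + ρ • (c * y) by simp; ring]
    exact Finset.add_mem_add hxy.1.2 (Finset.smul_mem_smul_finset hxy.2.2)
  · intro z _
    rcases Finset.eq_empty_or_nonempty ({y ∈ {x ∈ U | c * x ∈ U} ×ˢ {x ∈ U | c * x ∈ U} |
      y.1 + ρ * y.2 = z} : Finset (k × k)) with h | ⟨⟨x₀, y₀⟩, h₀⟩
    · rw [h]; simp
    simp only [Finset.mem_product, Finset.mem_filter] at h₀
    refine Finset.card_le_card_of_injOn (fun y => y.1 - x₀) ?_ ?_
    · rintro ⟨x, y⟩ hxy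
      simp only [Finset.coe_filter, Set.mem_ofPred_eq, Finset.mem_product, Finset.mem_filter] at hxy
      simp only [Finset.coe_filter, Set.mem_ofPred_eq, Finset.mem_inter]
      have e : x - x₀ = ρ • (y₀ - y) := by
        simp only [smul_eq_mul]; linear_combination hxy.2 - h₀.2
      refine ⟨⟨Finset.sub_mem_sub hxy.1.1.1 h₀.1.1.1, ?_⟩, ?_, ?_⟩
      · rw [e]; exact Finset.smul_mem_smul_finset (Finset.sub_mem_sub h₀.1.2.1 hxy.1.2.1)
      · rw [mul_sub]; exact Finset.sub_mem_sub hxy.1.1.2 h₀.1.1.2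
      · rw [e, show c * ρ • (y₀ - y) = ρ • (c * y₀ - c * y) by simp; ring]
        exact Finset.smul_mem_smul_finset (Finset.sub_mem_sub h₀.1.2.2 hxy.1.2.2)
    · rintro ⟨x, y⟩ hxy ⟨x', y'⟩ hxy' h
      simp only [Finset.coe_filter, Set.mem_ofPred_eq] at hxy hxy'
      have hx : x = x' := by simpa using h
      subst hx
      have : ρ * y = ρ * y' := by linear_combination hxy.2 - hxy'.2
      rw [mul_left_cancel₀ hρ this]

lemma IsApproxGroup.card_mul_sq_le {κ : ℕ} {U : Finset k} (hU : IsApproxGroup κ U) {ρ : k}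
    (hρ : ρ ≠ 0) {W : Finset k} {M b : ℝ} (hM : ∀ c ∈ W, M ≤ dilateCount U c) (hM0 : 0 ≤ M)
    (hb : ∀ c ∈ W, (dilateCount (U + ρ • U) c : ℝ) ≤ b) (hb0 : 0 ≤ b)
    (hMb : 2 * b ≤ M ^ 2) :
    #W * M ^ 2 * (#(U + ρ • U) : ℝ) ^ 2 ≤ 2 * b * κ ^ 8 * (#U : ℝ) ^ 4 := by
  set S := (U - U) ∩ ρ • (U - U) with hS
  have h1 : ∀ c ∈ W, M ^ 2 ≤ 2 * b * #{x ∈ S | x ≠ 0 ∧ c * x ∈ S} := by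
    intro c hc
    have e1 : M ^ 2 ≤ dilateCount S c * b := by
      calc M ^ 2 ≤ (dilateCount U c : ℝ) ^ 2 := by gcongr; exact hM c hc
        _ ≤ (dilateCount S c : ℝ) * dilateCount (U + ρ • U) c := by
            exact_mod_cast sq_dilateCount_le hρ U c
        _ ≤ _ := by gcongr; exact hb c hc
    have e2 : dilateCount S c ≤ #{x ∈ S | x ≠ 0 ∧ c * x ∈ S} + 1 := by
      have : ({x ∈ S | c * x ∈ S} : Finset k) ⊆
          insert 0 {x ∈ S | x ≠ 0 ∧ c * x ∈ S} := by
        intro x hx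
        rw [Finset.mem_filter] at hx
        rw [Finset.mem_insert, Finset.mem_filter]
        by_cases h : x = 0
        · exact Or.inl h
        · exact Or.inr ⟨hx.1, h, hx.2⟩
      exact (Finset.card_le_card this).trans (Finset.card_insert_le _ _)
    have e3 : (dilateCount S c : ℝ) ≤ #{x ∈ S | x ≠ 0 ∧ c * x ∈ S} + 1 := by exact_mod_cast e2
    nlinarith [mul_le_mul_of_nonneg_right e3 hb0]
  have h2 : #W * M ^ 2 ≤ 2 * b * (#S : ℝ) ^ 2 := by
    calc #W * M ^ 2 = ∑ c ∈ W, M ^ 2 := by simp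
      _ ≤ ∑ c ∈ W, 2 * b * #{x ∈ S | x ≠ 0 ∧ c * x ∈ S} := Finset.sum_le_sum h1
      _ = 2 * b * (∑ c ∈ W, #{x ∈ S | x ≠ 0 ∧ c * x ∈ S} : ℕ) := by
          push_cast; rw [Finset.mul_sum]
      _ ≤ _ := by
          gcongr
          exact_mod_cast sum_dilateCount_le S W
  have h3 : #S * #(U + ρ • U) ≤ (κ ^ 2 * #U) ^ 2 := by
    calc #S * #(U + ρ • U) = #(U + ρ • U) * #S := mul_comm _ _
      _ ≤ #(U + S) * #(S + ρ • U) := Finset.ruzsa_triangle_inequality_add_add_add _ _ _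
      _ ≤ #(U + (U - U)) * #(ρ • (U + (U - U))) := by
          refine Nat.mul_le_mul (Finset.card_le_card (Finset.add_subset_add_left
            Finset.inter_subset_left)) (Finset.card_le_card ?_)
          rw [add_comm S, smul_add]
          exact Finset.add_subset_add_left Finset.inter_subset_right
      _ ≤ #(U + (U - U)) * #(U + (U - U)) := Nat.mul_le_mul_left _ Finset.card_image_le
      _ ≤ (κ ^ 2 * #U) ^ 2 := by
          rw [sq]; exact Nat.mul_le_mul hU.card_triple_le hU.card_triple_le
  have h4 : (#S : ℝ) * #(U + ρ • U) ≤ (κ ^ 2 * #U) ^ 2 := by exact_mod_cast h3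
  calc #W * M ^ 2 * (#(U + ρ • U) : ℝ) ^ 2 ≤ 2 * b * (#S : ℝ) ^ 2 * (#(U + ρ • U) : ℝ) ^ 2 := by
        gcongr
    _ = 2 * b * ((#S : ℝ) * #(U + ρ • U)) ^ 2 := by ring
    _ ≤ 2 * b * ((κ ^ 2 * #U) ^ 2) ^ 2 := by gcongr
    _ = _ := by ring

end ApproximateGroups

section ApproximateGroups

variable {p : ℕ} [Fact p.Prime]

lemma sum_addEnergy_smul_le (U : Finset (ZMod p)) :
    ∑ ρ ∈ univ.erase (0 : ZMod p), addEnergy U (ρ • U) ≤ (p - 1) * #U ^ 2 + #U ^ 4 := by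
  have hE : ∀ ρ : ZMod p, addEnergy U (ρ • U) ≤
      #{x ∈ (U ×ˢ U) ×ˢ U ×ˢ U | x.1.1 + ρ * x.2.1 = x.1.2 + ρ * x.2.2} := by
    intro ρ
    refine (Finset.card_le_card ?_).trans (Finset.card_image_le
      (f := fun x : (ZMod p × ZMod p) × ZMod p × ZMod p => (x.1, (ρ * x.2.1, ρ * x.2.2))))
    rintro ⟨⟨a, b⟩, c, d⟩ h
    simp only [Finset.mem_filter, Finset.mem_product, Finset.mem_smul_finset] at h
    obtain ⟨⟨⟨ha, hb⟩, ⟨c, hc, rfl⟩, ⟨d, hd, rfl⟩⟩, h⟩ := h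
    refine Finset.mem_image.2 ⟨((a, b), (c, d)), ?_, rfl⟩
    simp only [Finset.mem_filter, Finset.mem_product]
    exact ⟨⟨⟨ha, hb⟩, hc, hd⟩, h⟩
  have hcard : #(univ.erase (0 : ZMod p)) = p - 1 := by
    rw [Finset.card_erase_of_mem (Finset.mem_univ _), Finset.card_univ, ZMod.card]
  calc ∑ ρ ∈ univ.erase (0 : ZMod p), addEnergy U (ρ • U)
      ≤ ∑ ρ ∈ univ.erase (0 : ZMod p),
        #{x ∈ (U ×ˢ U) ×ˢ U ×ˢ U | x.1.1 + ρ * x.2.1 = x.1.2 + ρ * x.2.2} :=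
        Finset.sum_le_sum fun ρ _ => hE ρ
    _ = ∑ x ∈ (U ×ˢ U) ×ˢ U ×ˢ U,
        #{ρ ∈ univ.erase (0 : ZMod p) | x.1.1 + ρ * x.2.1 = x.1.2 + ρ * x.2.2} := by
        simp_rw [Finset.card_filter]
        exact Finset.sum_comm
    _ ≤ ∑ x ∈ (U ×ˢ U) ×ˢ U ×ˢ U,
        ((if x.1.1 = x.1.2 ∧ x.2.1 = x.2.2 then p - 1 else 0) + 1) := by
        refine Finset.sum_le_sum ?_
        rintro ⟨⟨a, b⟩, c, d⟩ -
        simp only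
        split_ifs with h
        · exact (Finset.card_filter_le _ _).trans (by rw [hcard]; omega)
        · rw [zero_add, Finset.card_le_one]
          intro ρ hρ ρ' hρ'
          simp only [Finset.mem_filter] at hρ hρ'
          have hcd : c - d ≠ 0 := by
            intro hcd
            have hcd : c = d := sub_eq_zero.1 hcd
            refine h ⟨?_, hcd⟩
            have := hρ.2
            rw [hcd] at this
            exact add_right_cancel this
          refine mul_right_cancel₀ hcd ?_
          linear_combination hρ.2 - hρ'.2
    _ = (p - 1) * #U ^ 2 + #U ^ 4 := by
        rw [Finset.sum_add_distrib, ← Finset.sum_filter, Finset.sum_const, Finset.sum_const]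
        have : #{x ∈ (U ×ˢ U) ×ˢ U ×ˢ U | x.1.1 = x.1.2 ∧ x.2.1 = x.2.2} = #U ^ 2 := by
          rw [sq, ← Finset.card_product]
          refine Finset.card_nbij' (fun x => (x.1.1, x.2.1)) (fun y => ((y.1, y.1), (y.2, y.2)))
            ?_ ?_ ?_ ?_
          · rintro ⟨⟨a, b⟩, c, d⟩ h
            simp at h ⊢
            tauto
          · rintro ⟨a, b⟩ h
            simp at h ⊢
            tauto
          · rintro ⟨⟨a, b⟩, c, d⟩ h
            simp at h ⊢
            tauto
          · rintro ⟨a, b⟩ h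
            rfl
        rw [this]
        simp only [Finset.card_product, smul_eq_mul, mul_one]
        ring

lemma exists_le_card_add_smul {U : Finset (ZMod p)} (hU : U.Nonempty) {T : ℝ}
    (hT : 2 * T ≤ (#U : ℝ) ^ 2) (hTp : 2 * T ≤ p - 1) :
    ∃ ρ : ZMod p, T ≤ #(U + ρ • U) := by
  have hp1 : 1 < p := (Fact.out : p.Prime).one_lt
  have hcard : #(univ.erase (0 : ZMod p)) = p - 1 := by
    rw [Finset.card_erase_of_mem (Finset.mem_univ _), Finset.card_univ, ZMod.card]
  have hpc : ((p - 1 : ℕ) : ℝ) = p - 1 := by push_cast [hp1.le]; ring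
  have hp0 : (0 : ℝ) < p - 1 := by
    have : (1 : ℝ) < p := by exact_mod_cast hp1
    linarith
  have hu0 : (0 : ℝ) < #U := by exact_mod_cast hU.card_pos
  by_contra! hcon
  have h1 : ∀ ρ ∈ univ.erase (0 : ZMod p), (#U : ℝ) ^ 4 < T * addEnergy U (ρ • U) := by
    intro ρ hρ
    have hρ0 : ρ ≠ 0 := (Finset.mem_erase.1 hρ).1
    have := Finset.le_card_add_mul_addEnergy U (ρ • U)
    rw [Finset.card_smul_finset₀ hρ0] at this
    have h : (#U : ℝ) ^ 4 ≤ #(U + ρ • U) * (addEnergy U (ρ • U) : ℝ) := by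
      rw [← pow_add] at this
      exact_mod_cast this
    have hE : (0 : ℝ) < addEnergy U (ρ • U) := by
      by_contra! hE
      have : (0 : ℝ) < (#U : ℝ) ^ 4 := by positivity
      nlinarith [mul_nonneg (Nat.cast_nonneg (α := ℝ) #(U + ρ • U)) (neg_nonneg.2 hE)]
    exact h.trans_lt (mul_lt_mul_of_pos_right (hcon ρ) hE)
  have hT0 : 0 < T := (Nat.cast_nonneg _).trans_lt (hcon 0)
  have h2 := Finset.sum_lt_sum_of_nonempty (Finset.card_pos.1 (by omega)) h1
  rw [Finset.sum_const, hcard, ← Finset.mul_sum, nsmul_eq_mul, hpc] at h2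
  have h3 : (∑ ρ ∈ univ.erase (0 : ZMod p), (addEnergy U (ρ • U) : ℝ)) ≤
      (p - 1) * (#U : ℝ) ^ 2 + (#U : ℝ) ^ 4 := by
    rw [← hpc]
    exact_mod_cast sum_addEnergy_smul_le U
  have h4 : (p - 1) * (#U : ℝ) ^ 2 < T * (p - 1 + (#U : ℝ) ^ 2) := by
    have : (#U : ℝ) ^ 2 * ((p - 1) * (#U : ℝ) ^ 2) <
        (#U : ℝ) ^ 2 * (T * (p - 1 + (#U : ℝ) ^ 2)) := by
      nlinarith [mul_le_mul_of_nonneg_left h3 hT0.le]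
    exact lt_of_mul_lt_mul_left this (by positivity)
  nlinarith [mul_le_mul_of_nonneg_right hT hp0.le,
    mul_le_mul_of_nonneg_right hTp (sq_nonneg (#U : ℝ))]

lemma IsApproxGroup.exists_card_add_smul {κ : ℕ} {U : Finset (ZMod p)} (hU : IsApproxGroup κ U)
    {T : ℝ} (hUT : #U < T) (hT : 2 * T ≤ (#U : ℝ) ^ 2) (hTp : 2 * T ≤ p - 1) :
    ∃ ρ : ZMod p, ρ ≠ 0 ∧ T ≤ #(U + ρ • U) ∧ (#(U + ρ • U) : ℝ) ≤ κ * T := by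
  classical
  obtain ⟨F, hF, hcov⟩ := hU.cover
  have hne : U.Nonempty := ⟨0, hU.zero_mem⟩
  obtain ⟨ρ₀, hρ₀⟩ := exists_le_card_add_smul hne hT hTp
  have hex : ∃ j : ℕ, T ≤ #(U + (j : ZMod p) • U) := ⟨ρ₀.val, by rwa [ZMod.natCast_zmod_val]⟩
  have hzero : (#(U + (0 : ZMod p) • U) : ℝ) < T := by
    rw [Finset.zero_smul_finset hne, add_zero]; exact hUT
  obtain ⟨i, hi⟩ : ∃ i, Nat.find hex = i + 1 := by
    refine Nat.exists_eq_succ_of_ne_zero fun h => ?_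
    have := Nat.find_spec hex
    rw [h, Nat.cast_zero] at this
    linarith
  have hspec := Nat.find_spec hex
  have hmin := Nat.find_min hex (m := i) (by omega)
  rw [hi] at hspec
  refine ⟨((i + 1 : ℕ) : ZMod p), fun h => ?_, hspec, ?_⟩
  · rw [h] at hspec; linarith
  · have hsub : U + ((i + 1 : ℕ) : ZMod p) • U ⊆ F + (U + (i : ZMod p) • U) := by
      calc U + ((i + 1 : ℕ) : ZMod p) • U ⊆ U + ((i : ZMod p) • U + U) := by
            refine Finset.add_subset_add_left fun x hx => ?_
            obtain ⟨y, hy, rfl⟩ := Finset.mem_smul_finset.1 hx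
            refine Finset.mem_add.2 ⟨_, Finset.smul_mem_smul_finset hy, y, hy, ?_⟩
            simp; ring
        _ = (U + U) + (i : ZMod p) • U := by abel
        _ ⊆ (F + U) + (i : ZMod p) • U := Finset.add_subset_add_right hcov
        _ = F + (U + (i : ZMod p) • U) := by abel
    have h1 : #(U + ((i + 1 : ℕ) : ZMod p) • U) ≤ κ * #(U + (i : ZMod p) • U) :=
      (Finset.card_le_card hsub).trans (Finset.card_add_le.trans (Nat.mul_le_mul_right _ hF))
    calc (#(U + ((i + 1 : ℕ) : ZMod p) • U) : ℝ) ≤ κ * #(U + (i : ZMod p) • U) := by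
          exact_mod_cast h1
      _ ≤ κ * T := by gcongr; exact (not_le.1 hmin).le

end ApproximateGroups

section ApproximateGroups

lemma le_rpow_of_mul_sq_mul_sq_le {P w k μ ζ β ν e e' : ℝ} (hP : 1 < P) (hk0 : 0 ≤ k)
    (hk : k ≤ P ^ e') (h2 : 2 ≤ P ^ e)
    (h : w * (P ^ μ) ^ 2 * (P ^ ζ) ^ 2 ≤ 2 * P ^ β * k ^ 8 * (P ^ ν) ^ 4) :
    w ≤ P ^ (e + β + 8 * e' + 4 * ν - 2 * μ - 2 * ζ) := by
  have hP0 : 0 < P := by linarith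
  have h1 : 2 * P ^ β * k ^ 8 * (P ^ ν) ^ 4 ≤ P ^ e * P ^ β * (P ^ e') ^ 8 * (P ^ ν) ^ 4 := by
    gcongr
  have h3 := h.trans h1
  have e1 : P ^ e * P ^ β * (P ^ e') ^ 8 * (P ^ ν) ^ 4 =
      P ^ (e + β + 8 * e' + 4 * ν - 2 * μ - 2 * ζ) * ((P ^ μ) ^ 2 * (P ^ ζ) ^ 2) := by
    simp only [← Real.rpow_natCast, ← Real.rpow_mul hP0.le, ← Real.rpow_add hP0]
    congr 1
    push_cast
    ring
  rw [e1, mul_assoc] at h3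
  exact le_of_mul_le_mul_right h3 (by positivity)

lemma exists_rpow_eq {P x : ℝ} (hP : 1 < P) (hx : 0 < x) : ∃ ν : ℝ, x = P ^ ν :=
  ⟨Real.logb P x, (Real.rpow_logb (by linarith) hP.ne' hx).symm⟩

lemma dilateCount_le_card {R : Type*} [Mul R] [DecidableEq R] (U : Finset R) (c : R) :
    dilateCount U c ≤ #U := Finset.card_filter_le _ _

variable {p : ℕ} [Fact p.Prime]

lemma IsApproxGroup.card_popular_dilates_le {κ : ℕ} {U : Finset (ZMod p)}
    (hU : IsApproxGroup κ U) {e : ℝ} (he : e = 1 / 2000) (h2 : 2 ≤ (p : ℝ) ^ e)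
    (hκ : (κ : ℝ) ≤ (p : ℝ) ^ e) (hu : (p : ℝ) ^ ((13 : ℝ) / 40) ≤ #U)
    (hu' : (#U : ℝ) ≤ (p : ℝ) ^ (1 / 2 + 2 * e)) {M : ℝ}
    (hM : (#U : ℝ) ^ 2 * (p : ℝ) ^ (-(1 / 2) - 6 * e) ≤ M) (hMu : M ≤ #U)
    {W : Finset (ZMod p)} (hW : ∀ c ∈ W, M ≤ dilateCount U c) :
    M * #W ≤ (#U : ℝ) ^ 2 * (p : ℝ) ^ (-6 * e) := by
  have hp1 : 1 < p := (Fact.out : p.Prime).one_lt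
  set P : ℝ := (p : ℝ) with hPdef
  have hP : 1 < P := by rw [hPdef]; exact_mod_cast hp1
  have hP0 : 0 < P := by linarith
  have hmono : ∀ {x y : ℝ}, x ≤ y → P ^ x ≤ P ^ y := fun h =>
    Real.rpow_le_rpow_of_exponent_le hP.le h
  have hexp : ∀ {x y : ℝ}, P ^ x ≤ P ^ y → x ≤ y := fun h =>
    (Real.rpow_le_rpow_left_iff hP).1 h
  have hdouble : ∀ x : ℝ, 2 * P ^ x ≤ P ^ (x + e) := by
    intro x
    rw [add_comm, Real.rpow_add hP0]
    gcongr
  have hpred : P ^ (1 - e) ≤ P - 1 := by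
    have h1 := hdouble (1 - e)
    rw [sub_add_cancel, Real.rpow_one] at h1
    have : (2 : ℝ) ≤ P := by rw [hPdef]; exact_mod_cast hp1
    linarith
  have hu0 : (0 : ℝ) < #U := (Real.rpow_pos_of_pos hP0 _).trans_le hu
  have hM0 : 0 < M := lt_of_lt_of_le (by positivity) hM
  obtain ⟨ν, hν⟩ := exists_rpow_eq hP hu0
  obtain ⟨μ, hμ⟩ := exists_rpow_eq hP hM0
  have hν1 : 13 / 40 ≤ ν := hexp (by rwa [hν] at hu)
  have hν2 : ν ≤ 1 / 2 + 2 * e := hexp (by rwa [hν] at hu')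
  have hμν : μ ≤ ν := hexp (by rwa [hν, hμ] at hMu)
  have hμ1 : 2 * ν - 1 / 2 - 6 * e ≤ μ := by
    refine hexp ?_
    rw [← hμ]
    refine le_trans (le_of_eq ?_) hM
    rw [hν, ← Real.rpow_natCast, ← Real.rpow_mul hP0.le, ← Real.rpow_add hP0]
    congr 1; push_cast; ring
  have hUsq : ∀ x : ℝ, (P ^ x) ^ 2 = P ^ (2 * x) := by
    intro x
    rw [← Real.rpow_natCast, ← Real.rpow_mul hP0.le]; congr 1; push_cast; ring
  have hκP : ∀ x : ℝ, κ * P ^ x ≤ P ^ (x + e) := by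
    intro x
    rw [add_comm, Real.rpow_add hP0]
    gcongr
  have hκ2 : ((κ ^ 2 : ℕ) : ℝ) ≤ P ^ (2 * e) := by
    rw [← hUsq]; push_cast; gcongr
  suffices hgoal : (#W : ℝ) ≤ P ^ (2 * ν - μ - 6 * e) by
    calc M * #W ≤ P ^ μ * P ^ (2 * ν - μ - 6 * e) := by rw [hμ]; gcongr
      _ = (#U : ℝ) ^ 2 * P ^ (-6 * e) := by
        rw [hν, hUsq, ← Real.rpow_add hP0, ← Real.rpow_add hP0]; congr 1; ring
  rcases le_total (3 * (ν - μ)) (ν - 21 * e) with hc | hc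
  · -- few dilates are popular when the fibres are large
    obtain ⟨ρ, hρ0, hz1, hz2⟩ := hU.exists_card_add_smul (T := P ^ (2 * μ - 6 * e))
      (by rw [hν]; exact Real.rpow_lt_rpow_of_exponent_lt hP (by linarith))
      (by rw [hν, hUsq]; exact (hdouble _).trans (hmono (by linarith)))
      ((hdouble _).trans ((hmono (by linarith)).trans hpred))
    have hz0 : (0 : ℝ) < #(U + ρ • U) := (Real.rpow_pos_of_pos hP0 _).trans_le hz1
    obtain ⟨ζ, hζ⟩ := exists_rpow_eq hP hz0
    have hζ1 : 2 * μ - 6 * e ≤ ζ := hexp (by rwa [hζ] at hz1)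
    have hζ2 : ζ ≤ 2 * μ - 5 * e := hexp (by
      rw [← hζ]; exact hz2.trans ((hκP _).trans (hmono (by linarith))))
    have key := hU.card_mul_sq_le hρ0 hW hM0.le (b := #(U + ρ • U))
      (fun c _ => by exact_mod_cast dilateCount_le_card _ c) hz0.le
      (by rw [hζ, hμ, hUsq]; exact (hdouble _).trans (hmono (by linarith)))
    rw [hζ, hμ, hν] at key
    exact (le_rpow_of_mul_sq_mul_sq_le hP (Nat.cast_nonneg _) hκ h2 key).trans
      (hmono (by linarith))
  · -- otherwise split according to the popularity in a larger approximate group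
    obtain ⟨γ, hγ⟩ : ∃ γ, γ = (3 * (ν - μ) - ν) / 2 + 11 * e := ⟨_, rfl⟩
    obtain ⟨ρ, hρ0, hz1, hz2⟩ := hU.exists_card_add_smul (T := P ^ (2 * μ + γ - 2 * e))
      (by rw [hν]; exact Real.rpow_lt_rpow_of_exponent_lt hP (by linarith))
      (by rw [hν, hUsq]; exact (hdouble _).trans (hmono (by linarith)))
      ((hdouble _).trans ((hmono (by linarith)).trans hpred))
    set Z := U + ρ • U with hZ
    have hZU : IsApproxGroup (κ ^ 2) Z := hU.add_smul ρ
    have hz0 : (0 : ℝ) < #Z := (Real.rpow_pos_of_pos hP0 _).trans_le hz1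
    obtain ⟨ζ, hζ⟩ := exists_rpow_eq hP hz0
    have hζ1 : 2 * μ + γ - 2 * e ≤ ζ := hexp (by rwa [hζ] at hz1)
    have hζ2 : ζ ≤ 2 * μ + γ - e := hexp (by
      rw [← hζ]; exact hz2.trans ((hκP _).trans (hmono (by linarith))))
    set W₁ := {c ∈ W | (dilateCount Z c : ℝ) ≤ P ^ (ζ - γ)} with hW₁
    set W₂ := {c ∈ W | ¬ (dilateCount Z c : ℝ) ≤ P ^ (ζ - γ)} with hW₂
    have hb1 : (#W₁ : ℝ) ≤ P ^ (2 * ν - μ - 7 * e) := by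
      have key := hU.card_mul_sq_le hρ0 (W := W₁) (fun c hc => hW c (Finset.mem_filter.1 hc).1)
        hM0.le (fun c hc => (Finset.mem_filter.1 hc).2) (Real.rpow_pos_of_pos hP0 _).le
        (by rw [hμ, hUsq]; exact (hdouble _).trans (hmono (by linarith)))
      rw [← hZ, hζ, hμ, hν] at key
      exact (le_rpow_of_mul_sq_mul_sq_le hP (Nat.cast_nonneg _) hκ h2 key).trans
        (hmono (by linarith))
    have hb2 : (#W₂ : ℝ) ≤ P ^ (2 * ν - μ - 7 * e) := by
      obtain ⟨t, ht, ht1, ht2, ht3⟩ : ∃ t, ζ < t ∧ t ≤ 1 - 2 * e ∧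
          t ≤ 2 * (2 * μ + γ - 2 * e) - 2 * γ - 3 * e ∧
          19 * e + 2 * (2 * μ + γ - 2 * e) + 2 * γ - t ≤ 2 * ν - μ - 7 * e := by
        rcases le_total (2 * (2 * μ + γ - 2 * e) - 2 * γ - 3 * e) (1 - 2 * e) with h | h
        · exact ⟨_, by linarith, h, le_rfl, by linarith⟩
        · exact ⟨1 - 2 * e, by linarith, le_rfl, h, by linarith⟩
      obtain ⟨ρ', hρ', hv1, hv2⟩ := hZU.exists_card_add_smul (T := P ^ t)
        (by rw [hζ]; exact Real.rpow_lt_rpow_of_exponent_lt hP ht)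
        (by rw [hζ, hUsq]; exact (hdouble _).trans (hmono (by linarith)))
        ((hdouble _).trans ((hmono (by linarith)).trans hpred))
      have hv0 : (0 : ℝ) < #(Z + ρ' • Z) := (Real.rpow_pos_of_pos hP0 _).trans_le hv1
      obtain ⟨ω, hω⟩ := exists_rpow_eq hP hv0
      have hω1 : t ≤ ω := hexp (by rwa [hω] at hv1)
      have hω2 : ω ≤ t + 2 * e := hexp (by
        rw [← hω, add_comm t, Real.rpow_add hP0]
        exact hv2.trans (by gcongr))
      have key := hZU.card_mul_sq_le hρ' (W := W₂) (M := P ^ (ζ - γ))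
        (fun c hc => (not_le.1 (Finset.mem_filter.1 hc).2).le)
        (Real.rpow_pos_of_pos hP0 _).le (b := #(Z + ρ' • Z))
        (fun c _ => by exact_mod_cast dilateCount_le_card _ c) hv0.le
        (by rw [hω, hUsq]; exact (hdouble _).trans (hmono (by linarith)))
      rw [hω, hζ] at key
      exact (le_rpow_of_mul_sq_mul_sq_le hP (Nat.cast_nonneg _) hκ2 h2 key).trans
        (hmono (by linarith))
    have hsum : (#W : ℝ) = #W₁ + #W₂ := by
      have := Finset.card_filter_add_card_filter_not (s := W)
        (fun c => (dilateCount Z c : ℝ) ≤ P ^ (ζ - γ))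
      rw [← this]; push_cast; rfl
    rw [hsum]
    have := hdouble (2 * ν - μ - 7 * e)
    rw [show 2 * ν - μ - 7 * e + e = 2 * ν - μ - 6 * e by ring] at this
    linarith

end ApproximateGroups

section RatioSets

variable {p : ℕ} [Fact p.Prime]

lemma card_dilate_le_dilateCount {k : Type*} [Field k] [DecidableEq k] {A X U : Finset k}
    (hA : A - A ⊆ U) (hX : X - X ⊆ U) (c : k) : #{x ∈ X | c * x ∈ A} ≤ dilateCount U c := by
  rcases Finset.eq_empty_or_nonempty ({x ∈ X | c * x ∈ A} : Finset k) with h | ⟨x₀, h₀⟩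
  · rw [h]; simp
  rw [Finset.mem_filter] at h₀
  refine Finset.card_le_card_of_injOn (fun x => x - x₀) ?_ fun x _ y _ h => by simpa using h
  intro x hx
  simp only [Finset.coe_filter, Set.mem_ofPred_eq] at hx ⊢
  refine ⟨hX (Finset.sub_mem_sub hx.1 h₀.1), ?_⟩
  rw [mul_sub]
  exact hA (Finset.sub_mem_sub hx.2 h₀.2)

lemma card_mul_card_eq_sum_dilate {k : Type*} [Field k] [DecidableEq k] {A X D : Finset k}
    (h0 : (0 : k) ∉ X) (hD : ∀ a ∈ A, ∀ x ∈ X, a / x ∈ D) :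
    #A * #X = ∑ c ∈ D, #{x ∈ X | c * x ∈ A} := by
  rw [← Finset.card_product, ← Finset.card_sigma]
  refine Finset.card_nbij' (fun y => ⟨y.1 / y.2, y.2⟩) (fun y => (y.1 * y.2, y.2)) ?_ ?_ ?_ ?_
  · rintro ⟨a, x⟩ h
    simp only [Finset.coe_product, Set.mem_prod, Finset.mem_coe] at h
    have hx : x ≠ 0 := fun hx => h0 (hx ▸ h.2)
    simp only [Finset.coe_sigma, Set.mem_sigma_iff, Finset.mem_coe, Finset.mem_filter]
    exact ⟨hD a h.1 x h.2, h.2, by rw [div_mul_cancel₀ _ hx]; exact h.1⟩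
  · rintro ⟨c, x⟩ h
    simp only [Finset.coe_sigma, Set.mem_sigma_iff, Finset.mem_coe, Finset.mem_filter] at h
    simp only [Finset.coe_product, Set.mem_prod, Finset.mem_coe]
    exact ⟨h.2.2, h.2.1⟩
  · rintro ⟨a, x⟩ h
    simp only [Finset.coe_product, Set.mem_prod, Finset.mem_coe] at h
    have hx : x ≠ 0 := fun hx => h0 (hx ▸ h.2)
    simp [div_mul_cancel₀ _ hx]
  · rintro ⟨c, x⟩ h
    simp only [Finset.coe_sigma, Set.mem_sigma_iff, Finset.mem_coe, Finset.mem_filter] at h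
    have hx : x ≠ 0 := fun hx => h0 (hx ▸ h.2.1)
    simp [mul_div_cancel_right₀ _ hx]

lemma IsApproxGroup.card_mul_card_lt {κ : ℕ} {U : Finset (ZMod p)}
    (hU : IsApproxGroup κ U) {e : ℝ} (he : e = 1 / 2000) (h4 : 4 ≤ (p : ℝ) ^ e)
    (hL : 4 * (Nat.log 2 p + 1) < (p : ℝ) ^ (2 * e))
    (hκ : (κ : ℝ) ≤ (p : ℝ) ^ e) (hu : (p : ℝ) ^ ((13 : ℝ) / 40) ≤ #U)
    (hu' : (#U : ℝ) ≤ (p : ℝ) ^ (1 / 2 + 2 * e)) {A X D : Finset (ZMod p)}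
    (h0 : (0 : ZMod p) ∉ X) (hA : A - A ⊆ U) (hX : X - X ⊆ U)
    (hD : ∀ a ∈ A, ∀ x ∈ X, a / x ∈ D) (hDc : (#D : ℝ) ≤ (p : ℝ) ^ (1 / 2 + e)) :
    (#A * #X : ℝ) < (#U : ℝ) ^ 2 * (p : ℝ) ^ (-4 * e) := by
  have hp1 : 1 < p := (Fact.out : p.Prime).one_lt
  have hP : (1 : ℝ) < p := by exact_mod_cast hp1
  have hP0 : (0 : ℝ) < p := by linarith
  by_contra! hcon
  set r : ZMod p → ℕ := fun c => #{x ∈ X | c * x ∈ A} with hr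
  have hsum : (#A * #X : ℝ) = ∑ c ∈ D, (r c : ℝ) := by
    exact_mod_cast card_mul_card_eq_sum_dilate h0 hD
  have hu0 : (0 : ℝ) < #U := (Real.rpow_pos_of_pos hP0 _).trans_le hu
  set N : ℝ := (#A * #X : ℝ) with hN
  have hN0 : 0 < N := lt_of_lt_of_le (by positivity) hcon
  have hD0 : (0 : ℝ) < #D := by
    rcases D.eq_empty_or_nonempty with rfl | h
    · simp at hsum; linarith
    · exact_mod_cast h.card_pos
  set a : ℝ := N / (4 * #D) with ha
  have ha0 : 0 < a := by positivity
  have haM : (#U : ℝ) ^ 2 * (p : ℝ) ^ (-(1 / 2) - 6 * e) ≤ a := by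
    rw [ha, le_div_iff₀ (by positivity)]
    calc (#U : ℝ) ^ 2 * (p : ℝ) ^ (-(1 / 2) - 6 * e) * (4 * #D)
        ≤ (#U : ℝ) ^ 2 * (p : ℝ) ^ (-(1 / 2) - 6 * e) * ((p : ℝ) ^ e * (p : ℝ) ^ (1 / 2 + e)) := by
          gcongr
      _ = (#U : ℝ) ^ 2 * (p : ℝ) ^ (-4 * e) := by
          rw [mul_assoc, ← Real.rpow_add hP0, ← Real.rpow_add hP0]
          congr 2; ring
      _ ≤ N := hcon
  set S := {c ∈ D | (r c : ℝ) ≤ 2 * a} with hS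
  set B := {c ∈ D | ¬ (r c : ℝ) ≤ 2 * a} with hB
  have hsplit : N = ∑ c ∈ S, (r c : ℝ) + ∑ c ∈ B, (r c : ℝ) := by
    rw [hsum, Finset.sum_filter_add_sum_filter_not]
  have hsmall : ∑ c ∈ S, (r c : ℝ) ≤ N / 2 := by
    calc ∑ c ∈ S, (r c : ℝ) ≤ ∑ c ∈ S, 2 * a :=
          Finset.sum_le_sum fun c hc => (Finset.mem_filter.1 hc).2
      _ = #S * (2 * a) := by rw [Finset.sum_const, nsmul_eq_mul]
      _ ≤ #D * (2 * a) := by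
          refine mul_le_mul_of_nonneg_right ?_ (by linarith)
          exact_mod_cast Finset.card_le_card (Finset.filter_subset _ _)
      _ = N / 2 := by
          have : a * (4 * #D) = N := div_mul_cancel₀ _ (by linarith)
          linarith
  have hrp : ∀ c, r c ≤ p := fun c => by
    refine (Finset.card_le_univ _).trans_eq ?_
    rw [ZMod.card]
  have hmaps : ∀ c ∈ B, Nat.log 2 (r c) ∈ range (Nat.log 2 p + 1) := by
    intro c _
    exact Finset.mem_range.2 (Nat.lt_succ_of_le (Nat.log_mono_right (hrp c)))
  have hpos : 0 < (#U : ℝ) ^ 2 * (p : ℝ) ^ (-6 * e) :=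
    mul_pos (pow_pos hu0 2) (Real.rpow_pos_of_pos hP0 _)
  have hlarge : ∑ c ∈ B, (r c : ℝ) ≤
      (Nat.log 2 p + 1 : ℕ) * (2 * ((#U : ℝ) ^ 2 * (p : ℝ) ^ (-6 * e))) := by
    rw [← Finset.sum_fiberwise_of_maps_to hmaps, ← nsmul_eq_mul]
    refine (Finset.sum_le_card_nsmul _ _ _ fun i _ => ?_).trans_eq (by rw [Finset.card_range])
    set Wi := {c ∈ B | Nat.log 2 (r c) = i}
    have hWi : ∀ c ∈ Wi, 2 * a < r c ∧ (2 : ℝ) ^ i ≤ r c ∧ (r c : ℝ) ≤ 2 * 2 ^ i := by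
      intro c hc
      obtain ⟨hcB, hi⟩ := Finset.mem_filter.1 hc
      have h1 : 2 * a < r c := not_le.1 (Finset.mem_filter.1 hcB).2
      have hr0 : r c ≠ 0 := by
        intro h; rw [h] at h1; push_cast at h1; linarith
      refine ⟨h1, ?_, ?_⟩
      · have := Nat.pow_log_le_self 2 hr0
        rw [hi] at this
        exact_mod_cast this
      · have := (Nat.lt_pow_succ_log_self (b := 2) (by norm_num) (r c)).le
        rw [hi, pow_succ, mul_comm] at this
        exact_mod_cast this
    have hle : ∀ c, (r c : ℝ) ≤ dilateCount U c := fun c => by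
      exact_mod_cast card_dilate_le_dilateCount hA hX c
    rcases Wi.eq_empty_or_nonempty with h | ⟨c₀, h₀⟩
    · rw [h, Finset.sum_empty]; exact mul_nonneg zero_le_two hpos.le
    obtain ⟨g1, g2, g3⟩ := hWi c₀ h₀
    have key := hU.card_popular_dilates_le he (by linarith) hκ hu hu' (M := (2 : ℝ) ^ i)
      (haM.trans (by linarith))
      (g2.trans ((hle c₀).trans (by exact_mod_cast dilateCount_le_card U c₀)))
      (W := Wi) fun c hc => (hWi c hc).2.1.trans (hle c)
    calc ∑ c ∈ Wi, (r c : ℝ) ≤ ∑ c ∈ Wi, 2 * (2 : ℝ) ^ i :=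
          Finset.sum_le_sum fun c hc => (hWi c hc).2.2
      _ = 2 * ((2 : ℝ) ^ i * #Wi) := by rw [Finset.sum_const, nsmul_eq_mul]; ring
      _ ≤ _ := mul_le_mul_of_nonneg_left key zero_le_two
  have hfin : (Nat.log 2 p + 1 : ℕ) * (2 * ((#U : ℝ) ^ 2 * (p : ℝ) ^ (-6 * e))) < N / 2 := by
    have h1 : (p : ℝ) ^ (2 * e) * ((#U : ℝ) ^ 2 * (p : ℝ) ^ (-6 * e)) ≤ N := by
      refine le_trans (le_of_eq ?_) hcon
      rw [mul_left_comm, ← Real.rpow_add hP0]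
      congr 2; ring
    have := mul_lt_mul_of_pos_right hL hpos
    push_cast
    linarith
  linarith

end RatioSets

section SmallDoubling

lemma hoeffding_card_le {ι : Type*} {A : Finset ι} (m : ℕ) {ξ : ι → ℝ} (h1 : ∀ a ∈ A, |ξ a| ≤ 1)
    (h0 : ∑ a ∈ A, ξ a = 0) {ε : ℝ} (hε : 0 ≤ ε) :
    (#{α ∈ Fintype.piFinset fun _ : Fin m => A | ε * m < ∑ j, ξ (α j)} : ℝ) ≤
      Real.exp (-(ε ^ 2 * m / 2)) * (#A : ℝ) ^ m := by
  have hconv : ∀ a ∈ A, Real.exp (ε * ξ a) ≤ Real.cosh ε + ξ a * Real.sinh ε := by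
    intro a ha
    obtain ⟨hl, hr⟩ := abs_le.1 (h1 a ha)
    have := (convexOn_exp.2 (Set.mem_univ (-ε)) (Set.mem_univ ε)
      (show 0 ≤ (1 - ξ a) / 2 by linarith) (show 0 ≤ (1 + ξ a) / 2 by linarith) (by ring))
    simp only [smul_eq_mul] at this
    rw [show (1 - ξ a) / 2 * -ε + (1 + ξ a) / 2 * ε = ε * ξ a by ring] at this
    rw [Real.cosh_eq, Real.sinh_eq]
    linarith
  have hmgf : ∑ a ∈ A, Real.exp (ε * ξ a) ≤ #A * Real.exp (ε ^ 2 / 2) := by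
    calc ∑ a ∈ A, Real.exp (ε * ξ a) ≤ ∑ a ∈ A, (Real.cosh ε + ξ a * Real.sinh ε) :=
          Finset.sum_le_sum hconv
      _ = #A * Real.cosh ε := by
          rw [Finset.sum_add_distrib, ← Finset.sum_mul, h0]; simp
      _ ≤ _ := by gcongr; exact Real.cosh_le_exp_half_sq ε
  have hprod : ∑ α ∈ Fintype.piFinset fun _ : Fin m => A, Real.exp (ε * ∑ j, ξ (α j)) =
      (∑ a ∈ A, Real.exp (ε * ξ a)) ^ m := by
    have := (Finset.prod_univ_sum (fun _ : Fin m => A) (fun _ a => Real.exp (ε * ξ a))).symm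
    rw [Finset.prod_const, Finset.card_univ, Fintype.card_fin] at this
    rw [← this]
    refine Finset.sum_congr rfl fun α _ => ?_
    rw [Finset.mul_sum, Real.exp_sum]
  have hmarkov : #{α ∈ Fintype.piFinset fun _ : Fin m => A | ε * m < ∑ j, ξ (α j)} *
      Real.exp (ε * (ε * m)) ≤ (#A * Real.exp (ε ^ 2 / 2)) ^ m := by
    calc #{α ∈ Fintype.piFinset fun _ : Fin m => A | ε * m < ∑ j, ξ (α j)} *
          Real.exp (ε * (ε * m))
        = ∑ α ∈ Fintype.piFinset fun _ : Fin m => A with ε * m < ∑ j, ξ (α j),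
          Real.exp (ε * (ε * m)) := by rw [Finset.sum_const, nsmul_eq_mul]
      _ ≤ ∑ α ∈ Fintype.piFinset fun _ : Fin m => A with ε * m < ∑ j, ξ (α j),
          Real.exp (ε * ∑ j, ξ (α j)) := by
          refine Finset.sum_le_sum fun α hα => Real.exp_le_exp.2 ?_
          exact mul_le_mul_of_nonneg_left (Finset.mem_filter.1 hα).2.le hε
      _ ≤ ∑ α ∈ Fintype.piFinset fun _ : Fin m => A, Real.exp (ε * ∑ j, ξ (α j)) :=
          Finset.sum_le_sum_of_subset_of_nonneg (Finset.filter_subset _ _)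
            fun _ _ _ => (Real.exp_pos _).le
      _ ≤ _ := by
          rw [hprod]
          exact pow_le_pow_left₀ (Finset.sum_nonneg fun _ _ => (Real.exp_pos _).le) hmgf m
  rw [mul_pow, ← Real.exp_nat_mul] at hmarkov
  have hpos := Real.exp_pos (ε * (ε * m))
  rw [← le_div_iff₀ hpos] at hmarkov
  refine hmarkov.trans_eq ?_
  rw [mul_div_assoc, ← Real.exp_sub, mul_comm]
  congr 2
  ring

variable {G : Type*} [AddCommGroup G] [DecidableEq G]

lemma card_nsmul_sub_nsmul_le {A : Finset G} (hA : A.Nonempty) {K : ℝ}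
    (hK : (#(A + A) : ℝ) ≤ K * #A) (m n : ℕ) : (#(m • A - n • A) : ℝ) ≤ K ^ (m + n) * #A := by
  have h := Finset.pluennecke_ruzsa_inequality_nsmul_sub_nsmul_add hA A m n
  have h' : (#(m • A - n • A) : ℝ) ≤ ((#(A + A) : ℝ) / #A) ^ (m + n) * #A := by
    have := (NNRat.cast_le (K := ℝ)).2 h
    push_cast at this
    exact this
  have hA0 : (0 : ℝ) < #A := by exact_mod_cast hA.card_pos
  refine h'.trans ?_
  gcongr
  rwa [div_le_iff₀ hA0]

lemma exists_popular_fiber {α β : Type*} [DecidableEq β] {s : Finset α} {t : Finset β}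
    {f : α → β} (hf : ∀ a ∈ s, f a ∈ t) (ht : t.Nonempty) {k : ℝ} (hk : (#t : ℝ) ≤ k) :
    ∃ y ∈ t, (#s : ℝ) ≤ k * #{x ∈ s | f x = y} := by
  have ht0 : (0 : ℝ) < #t := by exact_mod_cast ht.card_pos
  obtain ⟨y, hy, h⟩ := Finset.exists_le_card_fiber_of_nsmul_le_card_of_maps_to hf ht
    (b := (#s : ℝ) / #t) (by rw [nsmul_eq_mul, mul_div_cancel₀ _ ht0.ne'])
  refine ⟨y, hy, ?_⟩
  rw [div_le_iff₀ ht0, mul_comm] at h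
  exact h.trans (by gcongr)

lemma exists_cover_two_pow_nsmul {A : Finset G} (hA : A.Nonempty) {k : ℝ} (hk : 0 ≤ k)
    (hcard : (#(A + A - (A + A) + A) : ℝ) ≤ k * #A) (i : ℕ) :
    ∃ F : Finset G, (#F : ℝ) ≤ k ^ i ∧ ∀ a ∈ A, ∃ f ∈ F, 2 ^ i • a - f ∈ A - A := by
  obtain ⟨E, -, hE, hcov⟩ := Finset.ruzsa_covering_add hA hcard
  induction i with
  | zero =>
    obtain ⟨a₀, ha₀⟩ := hA
    exact ⟨{a₀}, by simp, fun a ha => ⟨a₀, by simp, by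
      rw [pow_zero, one_nsmul]; exact Finset.sub_mem_sub ha ha₀⟩⟩
  | succ i ih =>
    obtain ⟨F, hF, h⟩ := ih
    refine ⟨F.image (2 • ·) + E, ?_, fun a ha => ?_⟩
    · have h1 : #(F.image (2 • ·) + E) ≤ #F * #E :=
        Finset.card_add_le.trans (Nat.mul_le_mul_right _ Finset.card_image_le)
      calc (#(F.image (2 • ·) + E) : ℝ) ≤ #F * #E := by exact_mod_cast h1
        _ ≤ k ^ i * k := by gcongr
        _ = k ^ (i + 1) := (pow_succ _ _).symm
    · obtain ⟨f, hf, hfa⟩ := h a ha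
      obtain ⟨b, hb, c, hc, hbc⟩ := Finset.mem_sub.1 hfa
      have hmem : (b + b) - (c + c) ∈ A + A - (A + A) :=
        Finset.sub_mem_sub (Finset.add_mem_add hb hb) (Finset.add_mem_add hc hc)
      obtain ⟨g, hg, d, hd, hgd⟩ := Finset.mem_add.1 (hcov hmem)
      refine ⟨2 • f + g, Finset.add_mem_add (Finset.mem_image_of_mem _ hf) hg, ?_⟩
      have : 2 ^ (i + 1) • a - (2 • f + g) = d := by
        have e1 : 2 ^ (i + 1) • a = 2 • (2 ^ i • a) := by rw [← mul_nsmul, pow_succ]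
        have e2 : 2 ^ i • a = f + (b - c) := by rw [hbc]; abel
        have e3 : d = (b + b) - (c + c) - g := by rw [← hgd]; abel
        rw [e1, e2, e3]
        simp only [two_nsmul]
        abel
      rwa [this]

lemma exists_subset_two_pow_nsmul_sub_mem {A : Finset G} (hA : A.Nonempty) {k : ℝ} (hk : 1 ≤ k)
    (hcard : (#(A + A - (A + A) + A) : ℝ) ≤ k * #A) (J : ℕ) :
    ∃ A' ⊆ A, A'.Nonempty ∧ (#A : ℝ) ≤ k ^ (J ^ 2) * #A' ∧
      ∀ i < J, ∀ a ∈ A', ∀ b ∈ A', 2 ^ i • (a - b) ∈ A + A - (A + A) := by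
  have hk0 : 0 ≤ k := by linarith
  induction J with
  | zero => exact ⟨A, subset_rfl, hA, by simp, by simp⟩
  | succ J ih =>
    obtain ⟨A', hA', hne, hc, h⟩ := ih
    obtain ⟨F, hF, hcov⟩ := exists_cover_two_pow_nsmul hA hk0 hcard J
    choose! φ hφF hφ using hcov
    have hmaps : ∀ a ∈ A', φ a ∈ F := fun a ha => hφF a (hA' ha)
    obtain ⟨a₀, ha₀⟩ := hne
    obtain ⟨f, hf, hfib⟩ := exists_popular_fiber hmaps ⟨_, hmaps a₀ ha₀⟩ hF
    have hpos : (0 : ℝ) < #{x ∈ A' | φ x = f} := by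
      by_contra! hcon
      have h1 : (0 : ℝ) < #A' := by exact_mod_cast Finset.card_pos.2 ⟨a₀, ha₀⟩
      have h2 : 0 ≤ k ^ J := by positivity
      nlinarith
    refine ⟨{x ∈ A' | φ x = f}, (Finset.filter_subset _ _).trans hA',
      Finset.card_pos.1 (by exact_mod_cast hpos), ?_, ?_⟩
    · calc (#A : ℝ) ≤ k ^ (J ^ 2) * #A' := hc
        _ ≤ k ^ (J ^ 2) * (k ^ J * #{x ∈ A' | φ x = f}) := by gcongr
        _ = k ^ (J ^ 2 + J) * #{x ∈ A' | φ x = f} := by rw [pow_add, mul_assoc]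
        _ ≤ k ^ ((J + 1) ^ 2) * #{x ∈ A' | φ x = f} := by
            gcongr
            nlinarith
    · intro i hi a ha b hb
      rw [Finset.mem_filter] at ha hb
      rcases Nat.lt_succ_iff_lt_or_eq.1 hi with hi | rfl
      · exact h i hi a ha.1 b hb.1
      · obtain ⟨x, hx, y, hy, e1⟩ := Finset.mem_sub.1 (hφ a (hA' ha.1))
        obtain ⟨z, hz, w, hw, e2⟩ := Finset.mem_sub.1 (hφ b (hA' hb.1))
        have : 2 ^ i • (a - b) = (x + w) - (y + z) := by
          rw [ha.2] at e1
          rw [hb.2] at e2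
          have e1' : 2 ^ i • a = f + (x - y) := by rw [e1]; abel
          have e2' : 2 ^ i • b = f + (z - w) := by rw [e2]; abel
          rw [nsmul_sub, e1', e2']; abel
        rw [this]
        exact Finset.sub_mem_sub (Finset.add_mem_add hx hw) (Finset.add_mem_add hy hz)

end SmallDoubling

section AlmostPeriodicity

variable {G : Type*} [AddCommGroup G] [DecidableEq G]

/-- The proportion of `a ∈ A` with `x + a ∈ B`. -/
noncomputable def shiftDensity (A B : Finset G) (x : G) : ℝ := #{a ∈ A | x + a ∈ B} / #A

/-- The proportion of indices `j` with `x + α j ∈ B`. -/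
noncomputable def sampleDensity {m : ℕ} (B : Finset G) (α : Fin m → G) (x : G) : ℝ :=
  #{j | x + α j ∈ B} / m

lemma card_sampleDensity_far_le {A : Finset G} (hA : A.Nonempty) (B : Finset G) {m : ℕ}
    (hm : 0 < m) (x : G) {ε : ℝ} (hε : 0 ≤ ε) :
    (#{α ∈ Fintype.piFinset fun _ : Fin m => A |
      ε < |sampleDensity B α x - shiftDensity A B x|} : ℝ) ≤
      2 * Real.exp (-(ε ^ 2 * m / 2)) * (#A : ℝ) ^ m := by
  classical
  have hA0 : (0 : ℝ) < #A := by exact_mod_cast hA.card_pos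
  have hm0 : (0 : ℝ) < m := by exact_mod_cast hm
  set d := shiftDensity A B x with hd
  have hd0 : 0 ≤ d := by rw [hd, shiftDensity]; positivity
  have hd1 : d ≤ 1 := by
    rw [hd, shiftDensity, div_le_one hA0]
    exact_mod_cast Finset.card_filter_le _ _
  set ξ : G → ℝ := fun a => (if x + a ∈ B then 1 else 0) - d with hξ
  have hξ1 : ∀ a, |ξ a| ≤ 1 := by
    intro a
    rw [abs_le]
    simp only [hξ]
    split_ifs <;> constructor <;> linarith
  have hξ0 : ∑ a ∈ A, ξ a = 0 := by
    simp only [hξ]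
    rw [Finset.sum_sub_distrib, Finset.sum_boole, Finset.sum_const, nsmul_eq_mul, hd,
      shiftDensity, mul_div_cancel₀ _ hA0.ne', sub_self]
  have hsum : ∀ α : Fin m → G, ∑ j, ξ (α j) = m * (sampleDensity B α x - d) := by
    intro α
    simp only [hξ]
    rw [Finset.sum_sub_distrib, Finset.sum_boole, Finset.sum_const, nsmul_eq_mul,
      sampleDensity, mul_sub, mul_div_cancel₀ _ hm0.ne']
    simp
  have hup := hoeffding_card_le m (fun a _ => hξ1 a) hξ0 hε
  have hlow := hoeffding_card_le (A := A) m (ξ := fun a => -ξ a)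
    (fun a _ => by rw [abs_neg]; exact hξ1 a) (by rw [Finset.sum_neg_distrib, hξ0, neg_zero]) hε
  have hsub : ({α ∈ Fintype.piFinset fun _ : Fin m => A |
      ε < |sampleDensity B α x - d|} : Finset (Fin m → G)) ⊆
      {α ∈ Fintype.piFinset fun _ : Fin m => A | ε * m < ∑ j, ξ (α j)} ∪
      {α ∈ Fintype.piFinset fun _ : Fin m => A | ε * m < ∑ j, -ξ (α j)} := by
    intro α hα
    rw [Finset.mem_filter] at hα
    rw [Finset.mem_union, Finset.mem_filter, Finset.mem_filter, Finset.sum_neg_distrib, hsum]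
    rcases lt_abs.1 hα.2 with h | h
    · exact Or.inl ⟨hα.1, by nlinarith⟩
    · exact Or.inr ⟨hα.1, by nlinarith⟩
  have hcard : (#{α ∈ Fintype.piFinset fun _ : Fin m => A |
      ε < |sampleDensity B α x - d|} : ℝ) ≤
      #{α ∈ Fintype.piFinset fun _ : Fin m => A | ε * m < ∑ j, ξ (α j)} +
      #{α ∈ Fintype.piFinset fun _ : Fin m => A | ε * m < ∑ j, -ξ (α j)} := by
    exact_mod_cast (Finset.card_le_card hsub).trans (Finset.card_union_le _ _)
  linarith

variable [Fintype G]

/-- The `α ∈ A ^ m` that approximate the shift density up to `ε` off at most `η * #A` points. -/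
noncomputable def goodSamples (A B : Finset G) (m : ℕ) (ε η : ℝ) : Finset (Fin m → G) :=
  {α ∈ Fintype.piFinset fun _ : Fin m => A |
    (#{x | ε < |sampleDensity B α x - shiftDensity A B x|} : ℝ) ≤ η * #A}

lemma card_le_two_mul_card_goodSamples {A B : Finset G} (hA : A.Nonempty) {m : ℕ} (hm : 0 < m)
    {ε η L : ℝ} (hε : 0 ≤ ε) (hη : 0 < η) (hL : (#(B - A) : ℝ) ≤ L * #A)
    (h : 4 * L * Real.exp (-(ε ^ 2 * m / 2)) ≤ η) :
    (#A : ℝ) ^ m ≤ 2 * #(goodSamples A B m ε η) := by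
  classical
  have hA0 : (0 : ℝ) < #A := by exact_mod_cast hA.card_pos
  set Ω := Fintype.piFinset fun _ : Fin m => A with hΩ
  have hΩc : (#Ω : ℝ) = (#A : ℝ) ^ m := by
    rw [hΩ, Fintype.card_piFinset]; simp
  set far : (Fin m → G) → G → Prop :=
    fun α x => ε < |sampleDensity B α x - shiftDensity A B x| with hfar
  have hzero : ∀ α ∈ Ω, ∀ x, far α x → x ∈ B - A := by
    intro α hα x hx
    by_contra hxn
    have hne : ∀ a ∈ A, x + a ∉ B := by
      intro a ha hb
      exact hxn (Finset.mem_sub.2 ⟨x + a, hb, a, ha, by abel⟩)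
    have e1 : shiftDensity A B x = 0 := by
      rw [shiftDensity, Finset.filter_false_of_mem hne]; simp
    have e2 : sampleDensity B α x = 0 := by
      rw [sampleDensity, Finset.filter_false_of_mem
        fun j _ => hne _ (Fintype.mem_piFinset.1 hα j)]; simp
    simp only [hfar, e1, e2, sub_zero, abs_zero] at hx
    linarith
  have hdouble : ∑ α ∈ Ω, (#{x | far α x} : ℝ) ≤
      (L * #A) * (2 * Real.exp (-(ε ^ 2 * m / 2)) * (#A : ℝ) ^ m) := by
    calc ∑ α ∈ Ω, (#{x | far α x} : ℝ) ≤ ∑ α ∈ Ω, (#{x ∈ B - A | far α x} : ℝ) := by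
          refine Finset.sum_le_sum fun α hα => ?_
          have : ({x | far α x} : Finset G) ⊆ {x ∈ B - A | far α x} := by
            intro x hx
            rw [Finset.mem_filter] at hx ⊢
            exact ⟨hzero α hα x hx.2, hx.2⟩
          exact_mod_cast Finset.card_le_card this
      _ = ∑ x ∈ B - A, (#{α ∈ Ω | far α x} : ℝ) := by
          simp_rw [Finset.card_filter]
          push_cast
          exact Finset.sum_comm
      _ ≤ ∑ x ∈ B - A, 2 * Real.exp (-(ε ^ 2 * m / 2)) * (#A : ℝ) ^ m :=
          Finset.sum_le_sum fun x _ => card_sampleDensity_far_le hA B hm x hε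
      _ = #(B - A) * (2 * Real.exp (-(ε ^ 2 * m / 2)) * (#A : ℝ) ^ m) := by
          rw [Finset.sum_const, nsmul_eq_mul]
      _ ≤ _ := by gcongr
  set bad := {α ∈ Ω | ¬ (#{x | far α x} : ℝ) ≤ η * #A} with hbad
  have hmarkov : #bad * (η * #A) ≤ ∑ α ∈ Ω, (#{x | far α x} : ℝ) := by
    calc #bad * (η * #A) = ∑ α ∈ bad, η * #A := by rw [Finset.sum_const, nsmul_eq_mul]
      _ ≤ ∑ α ∈ bad, (#{x | far α x} : ℝ) :=
          Finset.sum_le_sum fun α hα => (not_le.1 (Finset.mem_filter.1 hα).2).le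
      _ ≤ _ := Finset.sum_le_sum_of_subset_of_nonneg (Finset.filter_subset _ _)
          fun _ _ _ => Nat.cast_nonneg _
  have hsplit : (#Ω : ℝ) = #(goodSamples A B m ε η) + #bad := by
    have := Finset.card_filter_add_card_filter_not (s := Ω)
      (fun α => (#{x | far α x} : ℝ) ≤ η * #A)
    rw [← this]; push_cast; rfl
  have hb : 2 * (#bad : ℝ) ≤ (#A : ℝ) ^ m := by
    have h1 := hmarkov.trans hdouble
    have h2 : (L * #A) * (2 * Real.exp (-(ε ^ 2 * m / 2)) * (#A : ℝ) ^ m) ≤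
        (η * #A) * ((#A : ℝ) ^ m / 2) := by
      have := mul_le_mul_of_nonneg_right h (show 0 ≤ #A * (#A : ℝ) ^ m / 2 by positivity)
      linarith
    have h3 : (η * #A) * #bad ≤ (η * #A) * ((#A : ℝ) ^ m / 2) := by linarith
    have := le_of_mul_le_mul_left h3 (by positivity)
    linarith
  linarith

end AlmostPeriodicity

section Periods

variable {G : Type*} [AddCommGroup G] [Fintype G]

lemma card_filter_add_right (P : G → Prop) [DecidablePred P] (c : G) :
    #{x | P (x + c)} = #{x | P x} := by
  refine Finset.card_bij (fun x _ => x + c) ?_ (fun x _ y _ h => add_right_cancel h) ?_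
  · intro x hx
    simpa using hx
  · intro y hy
    exact ⟨y - c, by simpa using hy, sub_add_cancel y c⟩

variable [DecidableEq G]

lemma card_shiftDensity_far_le {A B : Finset G} {m : ℕ} {ε η : ℝ} {β : Fin m → G} {c c' : G}
    (hc : (fun j => β j - c) ∈ goodSamples A B m ε η)
    (hc' : (fun j => β j - c') ∈ goodSamples A B m ε η) :
    (#{x | 2 * ε < |shiftDensity A B (x + (c - c')) - shiftDensity A B x|} : ℝ) ≤
      2 * η * #A := by
  classical
  have hshift : ∀ d x, sampleDensity B (fun j => β j - d) x = sampleDensity B β (x - d) := by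
    intro d x
    have : ∀ j, x + (β j - d) = x - d + β j := fun j => by abel
    simp only [sampleDensity, this]
  have hb := (Finset.mem_filter.1 hc).2
  have hb' := (Finset.mem_filter.1 hc').2
  rw [← card_filter_add_right _ (c - c')] at hb
  have hsub : ({x | 2 * ε < |shiftDensity A B (x + (c - c')) - shiftDensity A B x|} : Finset G) ⊆
      ({x | ε < |sampleDensity B (fun j => β j - c) (x + (c - c')) -
        shiftDensity A B (x + (c - c'))|} : Finset G) ∪
      ({x | ε < |sampleDensity B (fun j => β j - c') x - shiftDensity A B x|} : Finset G) := by
    intro x hx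
    rw [Finset.mem_filter] at hx
    rw [Finset.mem_union, Finset.mem_filter, Finset.mem_filter]
    by_contra! h
    have h1 := h.1 (Finset.mem_univ _)
    have h2 := h.2 (Finset.mem_univ _)
    rw [hshift, show x + (c - c') - c = x - c' by abel, abs_le] at h1
    rw [hshift, abs_le] at h2
    rcases lt_abs.1 hx.2 with h3 | h3 <;> linarith
  have : (#{x | 2 * ε < |shiftDensity A B (x + (c - c')) - shiftDensity A B x|} : ℝ) ≤
      #{x | ε < |sampleDensity B (fun j => β j - c) (x + (c - c')) -
        shiftDensity A B (x + (c - c'))|} +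
      #{x | ε < |sampleDensity B (fun j => β j - c') x - shiftDensity A B x|} := by
    exact_mod_cast (Finset.card_le_card hsub).trans (Finset.card_union_le _ _)
  linarith

lemma card_add_nsmul_lt_sub_le {F : G → ℝ} {t : G} {ε δ : ℝ} (hε : 0 ≤ ε) (hδ : 0 ≤ δ) {J : ℕ}
    (h : ∀ i < J, (#{x | ε < |F (x + 2 ^ i • t) - F x|} : ℝ) ≤ δ) {y : ℕ} (hy : y < 2 ^ J) :
    (#{x | F (x + y • t) < F x - ε * J} : ℝ) ≤ δ * J := by
  classical
  induction J generalizing y with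
  | zero =>
    obtain rfl : y = 0 := by simpa using hy
    simp
  | succ J ih =>
    have ih' := fun z hz => ih (fun i hi => h i (by omega)) (y := z) hz
    by_cases hyJ : y < 2 ^ J
    · have hsub : ({x | F (x + y • t) < F x - ε * ((J + 1 : ℕ) : ℝ)} : Finset G) ⊆
          ({x | F (x + y • t) < F x - ε * J} : Finset G) := by
        intro x hx
        rw [Finset.mem_filter] at hx ⊢
        refine ⟨hx.1, hx.2.trans_le ?_⟩
        push_cast
        linarith
      have h1 : (#{x | F (x + y • t) < F x - ε * ((J + 1 : ℕ) : ℝ)} : ℝ) ≤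
          #{x | F (x + y • t) < F x - ε * J} := by exact_mod_cast Finset.card_le_card hsub
      have h2 := ih' y hyJ
      push_cast at h1 ⊢
      linarith
    · obtain ⟨z, rfl⟩ := Nat.exists_eq_add_of_le (not_lt.1 hyJ)
      have hz : z < 2 ^ J := by rw [pow_succ] at hy; omega
      have h1 := h J (by omega)
      rw [← card_filter_add_right _ (z • t)] at h1
      have hsub : ({x | F (x + (2 ^ J + z) • t) < F x - ε * ((J + 1 : ℕ) : ℝ)} : Finset G) ⊆
          ({x | ε < |F (x + z • t + 2 ^ J • t) - F (x + z • t)|} : Finset G) ∪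
          ({x | F (x + z • t) < F x - ε * J} : Finset G) := by
        intro x hx
        rw [Finset.mem_filter] at hx
        rw [Finset.mem_union, Finset.mem_filter, Finset.mem_filter]
        by_contra! h
        have h1 := (abs_le.1 (h.1 (Finset.mem_univ _))).1
        have h2 := h.2 (Finset.mem_univ _)
        have h3 := hx.2
        rw [add_nsmul, show x + (2 ^ J • t + z • t) = x + z • t + 2 ^ J • t by abel] at h3
        push_cast at h3
        linarith
      have h2 : (#{x | F (x + (2 ^ J + z) • t) < F x - ε * ((J + 1 : ℕ) : ℝ)} : ℝ) ≤
          #{x | ε < |F (x + z • t + 2 ^ J • t) - F (x + z • t)|} +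
          #{x | F (x + z • t) < F x - ε * J} := by
        exact_mod_cast (Finset.card_le_card hsub).trans (Finset.card_union_le _ _)
      have h3 := ih' z hz
      push_cast at h2 ⊢
      linarith

lemma nsmul_mem_of_card_shiftDensity_far_le {A : Finset G} (hA : A.Nonempty) {J : ℕ} (hJ : 0 < J)
    {t : G} (h : ∀ i < J, (#{x | 2 * (1 / (4 * J : ℝ)) <
      |shiftDensity A (A + A) (x + 2 ^ i • t) - shiftDensity A (A + A) x|} : ℝ) ≤
      2 * (1 / (4 * J)) * #A) {y : ℕ} (hy : y < 2 ^ J) : y • t ∈ A + A - (A + A) := by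
  classical
  have hA0 : (0 : ℝ) < #A := by exact_mod_cast hA.card_pos
  have hJ0 : (0 : ℝ) < J := by exact_mod_cast hJ
  have hbad := card_add_nsmul_lt_sub_le (F := shiftDensity A (A + A)) (by positivity)
    (by positivity) h hy
  have e1 : 2 * (1 / (4 * J : ℝ)) * #A * J = #A / 2 := by field_simp; norm_num
  have e2 : 2 * (1 / (4 * J : ℝ)) * J = 1 / 2 := by field_simp; norm_num
  rw [e1, e2] at hbad
  have hex : ∃ x ∈ A, ¬ shiftDensity A (A + A) (x + y • t) < shiftDensity A (A + A) x - 1 / 2 := by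
    by_contra! hcon
    have : A ⊆ ({x | shiftDensity A (A + A) (x + y • t) < shiftDensity A (A + A) x - 1 / 2} :
        Finset G) := fun x hx => Finset.mem_filter.2 ⟨Finset.mem_univ _, hcon x hx⟩
    have : (#A : ℝ) ≤ #{x | shiftDensity A (A + A) (x + y • t) <
      shiftDensity A (A + A) x - 1 / 2} := by exact_mod_cast Finset.card_le_card this
    linarith
  obtain ⟨x, hx, hxy⟩ := hex
  have hx1 : shiftDensity A (A + A) x = 1 := by
    rw [shiftDensity, Finset.filter_true_of_mem fun a ha => Finset.add_mem_add hx ha,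
      div_self hA0.ne']
  rw [hx1, not_lt] at hxy
  have hne : ({a ∈ A | x + y • t + a ∈ A + A}).Nonempty := by
    rw [Finset.nonempty_iff_ne_empty]
    intro h0
    rw [shiftDensity, h0] at hxy
    norm_num at hxy
  obtain ⟨a, ha⟩ := hne
  rw [Finset.mem_filter] at ha
  exact Finset.mem_sub.2 ⟨_, ha.2, x + a, Finset.add_mem_add hx ha.1, by abel⟩

lemma exists_nsmul_mem_of_small_doubling {A : Finset G} (hA : A.Nonempty) {K : ℝ} (hK1 : 1 ≤ K)
    (hK : (#(A + A) : ℝ) ≤ K * #A) {J m : ℕ} (hJ : 0 < J) (hm : 0 < m)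
    (h : 4 * K ^ 3 * Real.exp (-((1 / (4 * J : ℝ)) ^ 2 * m / 2)) ≤ 1 / (4 * J)) :
    ∃ X : Finset G, (#A : ℝ) ≤ 2 ^ J * (K ^ 5) ^ (J ^ 2 + m * J) * #X ∧
      ∀ x ∈ X, ∀ y < 2 ^ J, y • x ∈ A + A - (A + A) := by
  classical
  have hA0 : (0 : ℝ) < #A := by exact_mod_cast hA.card_pos
  have hJ0 : (0 : ℝ) < J := by exact_mod_cast hJ
  have h5 : (#(A + A - (A + A) + A) : ℝ) ≤ K ^ 5 * #A := by
    have := card_nsmul_sub_nsmul_le hA hK 3 2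
    rwa [show 3 • A - 2 • A = A + A - (A + A) + A by
      rw [succ_nsmul, two_nsmul, sub_add_eq_add_sub]] at this
  have h3 : (#(A + A - A) : ℝ) ≤ K ^ 3 * #A := by
    have := card_nsmul_sub_nsmul_le hA hK 2 1
    rwa [two_nsmul, one_nsmul] at this
  have hk1 : 1 ≤ K ^ 5 := one_le_pow₀ hK1
  obtain ⟨A', -, ⟨a₀, ha₀⟩, hA'c, hA'⟩ := exists_subset_two_pow_nsmul_sub_mem hA hk1 h5 J
  set S := A'.image (· - a₀) with hS
  have hSc : #S = #A' := Finset.card_image_of_injective _ (sub_left_injective)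
  have hSmem : ∀ i < J, ∀ s ∈ S, 2 ^ i • s ∈ A + A - (A + A) := by
    intro i hi s hs
    obtain ⟨a, ha, rfl⟩ := Finset.mem_image.1 hs
    exact hA' i hi a ha a₀ ha₀
  set good := goodSamples A (A + A) m (1 / (4 * J : ℝ)) (1 / (4 * J)) with hgood
  have hgoodc : (#A : ℝ) ^ m ≤ 2 * #good :=
    card_le_two_mul_card_goodSamples hA hm (by positivity) (by positivity) h3 h
  have hgoodA : ∀ α ∈ good, ∀ j, α j ∈ A := fun α hα j =>
    Fintype.mem_piFinset.1 (Finset.mem_filter.1 hα).1 j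
  set T := Fintype.piFinset fun _ : Fin J => Fintype.piFinset fun _ : Fin m =>
    A + A - (A + A) + A with hT
  have hTc : (#T : ℝ) ≤ (K ^ 5 * #A) ^ (m * J) := by
    rw [hT, Fintype.card_piFinset]
    simp only [Fintype.card_piFinset, Finset.prod_const, Finset.card_univ, Fintype.card_fin]
    push_cast
    rw [← pow_mul]
    gcongr
  set Ω := (Fintype.piFinset fun _ : Fin J => good) with hΩ
  have hΩc : ((#A : ℝ) ^ m) ^ J ≤ 2 ^ J * #Ω := by
    rw [hΩ, Fintype.card_piFinset]
    simp only [Finset.prod_const, Finset.card_univ, Fintype.card_fin]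
    push_cast
    rw [← mul_pow]
    gcongr
  set f : (Fin J → Fin m → G) × G → Fin J → Fin m → G :=
    fun q i j => q.1 i j + 2 ^ (i : ℕ) • q.2 with hf
  have hmaps : ∀ q ∈ Ω ×ˢ S, f q ∈ T := by
    intro q hq
    rw [Finset.mem_product] at hq
    refine Fintype.mem_piFinset.2 fun i => Fintype.mem_piFinset.2 fun j => ?_
    simp only [hf]
    rw [add_comm (q.1 i j)]
    exact Finset.add_mem_add (hSmem i i.2 _ hq.2) (hgoodA _ (Fintype.mem_piFinset.1 hq.1 i) j)
  have hTne : T.Nonempty := by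
    rw [hT]
    have := (((hA.add hA).sub (hA.add hA)).add hA)
    simpa [Fintype.piFinset_nonempty] using fun _ _ => this
  obtain ⟨β, -, hβ⟩ := exists_popular_fiber hmaps hTne hTc
  set Sβ := {s ∈ S | ∀ i : Fin J, (fun j => β i j - 2 ^ (i : ℕ) • s) ∈ good} with hSβ
  have hfib : #{q ∈ Ω ×ˢ S | f q = β} ≤ #Sβ := by
    refine Finset.card_le_card_of_injOn Prod.snd ?_ ?_
    · intro q hq
      rw [Finset.mem_coe, Finset.mem_filter, Finset.mem_product] at hq
      rw [Finset.mem_coe, hSβ, Finset.mem_filter]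
      refine ⟨hq.1.2, fun i => ?_⟩
      have : (fun j => β i j - 2 ^ (i : ℕ) • q.2) = q.1 i := by
        funext j
        rw [← hq.2]
        simp [hf]
      rw [this]
      exact Fintype.mem_piFinset.1 hq.1.1 i
    · rintro ⟨q, s⟩ hq ⟨q', s'⟩ hq' hss
      rw [Finset.mem_coe, Finset.mem_filter] at hq hq'
      simp only at hss
      subst hss
      have := hq.2.trans hq'.2.symm
      congr 1
      funext i j
      have := congrFun (congrFun this i) j
      simpa [hf] using this
  have hcount : (#S : ℝ) ≤ 2 ^ J * (K ^ 5) ^ (m * J) * #Sβ := by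
    have e : (#(Ω ×ˢ S) : ℝ) = #Ω * #S := by rw [Finset.card_product]; push_cast; ring
    rw [e] at hβ
    have hfib' : (#{q ∈ Ω ×ˢ S | f q = β} : ℝ) ≤ #Sβ := by exact_mod_cast hfib
    have hAm : (0 : ℝ) < #A ^ (m * J) := by positivity
    rw [← pow_mul] at hΩc
    refine le_of_mul_le_mul_left ?_ hAm
    calc (#A : ℝ) ^ (m * J) * #S ≤ 2 ^ J * #Ω * #S := by gcongr
      _ = 2 ^ J * (#Ω * #S) := by ring
      _ ≤ 2 ^ J * ((K ^ 5 * #A) ^ (m * J) * #{q ∈ Ω ×ˢ S | f q = β}) := by gcongr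
      _ ≤ 2 ^ J * ((K ^ 5 * #A) ^ (m * J) * #Sβ) := by gcongr
      _ = _ := by rw [mul_pow]; ring
  have hSβne : Sβ.Nonempty := by
    rw [Finset.nonempty_iff_ne_empty]
    intro h0
    rw [h0] at hcount
    have : (0 : ℝ) < #S := by
      rw [hSc]; exact_mod_cast Finset.card_pos.2 ⟨a₀, ha₀⟩
    simp at hcount
    simp [hcount] at this
  obtain ⟨s₀, hs₀⟩ := hSβne
  refine ⟨Sβ.image (· - s₀), ?_, ?_⟩
  · rw [Finset.card_image_of_injective _ sub_left_injective]
    calc (#A : ℝ) ≤ (K ^ 5) ^ (J ^ 2) * #S := by rw [hSc]; exact hA'c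
      _ ≤ (K ^ 5) ^ (J ^ 2) * (2 ^ J * (K ^ 5) ^ (m * J) * #Sβ) := by gcongr
      _ = _ := by rw [pow_add]; ring
  · intro x hx y hy
    obtain ⟨s, hs, rfl⟩ := Finset.mem_image.1 hx
    refine nsmul_mem_of_card_shiftDensity_far_le hA hJ (fun i hi => ?_) hy
    have := card_shiftDensity_far_le ((Finset.mem_filter.1 hs).2 ⟨i, hi⟩)
      ((Finset.mem_filter.1 hs₀).2 ⟨i, hi⟩)
    simpa only [nsmul_sub] using this

end Periods

section QuadraticResidues

variable {p : ℕ} [Fact p.Prime]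

lemma exists_div_mem_of_nsmul_mem (hp : 1000 ≤ p) {J : ℕ} (hJ : 2 ^ J ≤ p)
    (hJ' : p ≤ 2 ^ (2 ^ J - 1)) {A X : Finset (ZMod p)} (h0 : 0 ∉ X)
    (hX : ∀ x ∈ X, ∀ y < 2 ^ J, y • x ∈ A + A - (A + A))
    (hR : A + A + A - A - A ⊆ quadRes p) :
    ∃ D : Finset (ZMod p), (∀ a ∈ A, ∀ x ∈ X, a / x ∈ D) ∧
      #D ≤ 2 * (1 + 41 * (2 ^ J * Nat.sqrt p)) := by
  set Y : Finset (ZMod p) := (Finset.Ico 1 (2 ^ J)).image Nat.cast with hY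
  have hYc : #Y = 2 ^ J - 1 := by
    rw [hY, Finset.card_image_of_injOn, Nat.card_Ico]
    intro y hy z hz h
    simp only [Finset.coe_Ico, Set.mem_Ico] at hy hz
    have := (ZMod.natCast_eq_natCast_iff' y z p).1 h
    rwa [Nat.mod_eq_of_lt (by omega), Nat.mod_eq_of_lt (by omega)] at this
  have hY0 : (0 : ZMod p) ∉ Y := by
    intro h
    obtain ⟨y, hy, h⟩ := Finset.mem_image.1 h
    rw [Finset.mem_Ico] at hy
    have := Nat.le_of_dvd (by omega) ((ZMod.natCast_eq_zero_iff y p).1 h)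
    omega
  have hcard : ∀ σ : ℤ, σ = 1 ∨ σ = -1 →
      #{t : ZMod p | ∀ y ∈ Y, quadraticChar (ZMod p) (t + y) = σ} ≤
        1 + 41 * (2 ^ J * Nat.sqrt p) := by
    intro σ hσ
    have h1 := card_forall_quadraticChar_eq_le hp hY0 hσ
    rw [hYc] at h1
    refine le_of_mul_le_mul_left (h1.trans ?_) (pow_pos two_pos (2 ^ J - 1))
    rw [mul_add, mul_one]
    gcongr
    exact Nat.sub_le _ _
  refine ⟨({t : ZMod p | ∀ y ∈ Y, quadraticChar (ZMod p) (t + y) = 1} : Finset (ZMod p)) ∪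
    ({t : ZMod p | ∀ y ∈ Y, quadraticChar (ZMod p) (t + y) = -1} : Finset (ZMod p)), ?_, ?_⟩
  · intro a ha x hx
    have hx0 : x ≠ 0 := fun h => h0 (h ▸ hx)
    have key : ∀ y ∈ Y, quadraticChar (ZMod p) (a / x + y) = quadraticChar (ZMod p) x⁻¹ := by
      intro y hy
      obtain ⟨n, hn, rfl⟩ := Finset.mem_image.1 hy
      have hn' := hX x hx n (Finset.mem_Ico.1 hn).2
      obtain ⟨u, hu, v, hv, huv⟩ := Finset.mem_sub.1 hn'
      obtain ⟨b, hb, c, hc, rfl⟩ := Finset.mem_add.1 hu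
      obtain ⟨d, hd, f, hf, rfl⟩ := Finset.mem_add.1 hv
      have hmem : a + n * x ∈ quadRes p := by
        apply hR
        have : a + n * x = a + b + c - d - f := by
          rw [← nsmul_eq_mul, ← huv]; ring
        rw [this]
        exact Finset.sub_mem_sub (Finset.sub_mem_sub
          (Finset.add_mem_add (Finset.add_mem_add ha hb) hc) hd) hf
      obtain ⟨w, hw0, hw⟩ := (Finset.mem_filter.1 hmem).2
      have e : a / x + n = (a + n * x) * x⁻¹ := by field_simp
      rw [e, map_mul, ← hw, quadraticChar_sq_one' hw0, one_mul]
    rw [Finset.mem_union, Finset.mem_filter, Finset.mem_filter]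
    rcases quadraticChar_dichotomy (inv_ne_zero hx0) with h | h
    · exact Or.inl ⟨Finset.mem_univ _, fun y hy => (key y hy).trans h⟩
    · exact Or.inr ⟨Finset.mem_univ _, fun y hy => (key y hy).trans h⟩
  · refine (Finset.card_union_le _ _).trans ?_
    have h1 := hcard 1 (Or.inl rfl)
    have h2 := hcard (-1) (Or.inr rfl)
    omega

section FourFold

variable {G : Type*} [AddCommGroup G] [DecidableEq G] {A : Finset G}

lemma sub_subset_four_nsmul_sub (hA : A.Nonempty) : A - A ⊆ 4 • A - 4 • A := by
  have h3 : (0 : G) ∈ 3 • A - 3 • A := by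
    obtain ⟨a, ha⟩ := hA.nsmul (n := 3)
    rw [← sub_self a]
    exact Finset.sub_mem_sub ha ha
  intro x hx
  rw [show 4 = 1 + 3 from rfl, add_nsmul, one_nsmul, ← sub_add_sub_comm, ← add_zero x]
  exact Finset.add_mem_add hx h3

lemma card_le_card_four_nsmul_sub (hA : A.Nonempty) : #A ≤ #(4 • A - 4 • A) := by
  have h1 : 4 • A - 4 • A = A + (3 • A - 4 • A) := by
    nth_rewrite 1 [show 4 • A = A + 3 • A by
      rw [show 4 = 1 + 3 from rfl, add_nsmul, one_nsmul]]
    rw [add_sub_assoc]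
  rw [h1]
  exact Finset.card_le_card_add_right ((hA.nsmul).sub (hA.nsmul))

lemma two_add_two_sub_sub : A + A - (A + A) - (A + A - (A + A)) = 4 • A - 4 • A := by
  rw [show 4 = 2 + 2 from rfl, add_nsmul, two_nsmul]
  rw [sub_sub_eq_add_sub, sub_add_eq_add_sub, sub_sub]

end FourFold

lemma exists_isApproxGroup_of_small_doubling {G : Type*} [AddCommGroup G] [DecidableEq G]
    {A : Finset G} (hA : A.Nonempty) {K : ℝ} (hK : (#(A + A) : ℝ) ≤ K * #A) :
    ∃ κ : ℕ, (κ : ℝ) ≤ K ^ 17 ∧ IsApproxGroup κ (4 • A - 4 • A) := by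
  have h17 : (#(4 • A - 4 • A + (4 • A - 4 • A) + A) : ℝ) ≤ K ^ 17 * #A := by
    have := card_nsmul_sub_nsmul_le hA hK 9 8
    rwa [show 9 • A - 8 • A = 4 • A - 4 • A + (4 • A - 4 • A) + A by
      rw [show 9 = 4 + 4 + 1 from rfl, show 8 = 4 + 4 from rfl, add_nsmul, add_nsmul,
        one_nsmul, sub_add_sub_comm, sub_add_eq_add_sub]] at this
  have hsub := sub_subset_four_nsmul_sub hA
  obtain ⟨F, -, hF, hcov⟩ := Finset.ruzsa_covering_add hA h17
  obtain ⟨a, ha⟩ := hA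
  refine ⟨#F, hF, ?_, ?_, F, le_rfl, hcov.trans (Finset.add_subset_add_left hsub)⟩
  · apply hsub
    rw [← sub_self a]
    exact Finset.sub_mem_sub ha ha
  · intro x hx
    obtain ⟨y, hy, z, hz, rfl⟩ := Finset.mem_sub.1 hx
    rw [neg_sub]
    exact Finset.sub_mem_sub hz hy

set_option maxHeartbeats 400000 in
lemma card_lt_of_small_loss (hp : 1000 ≤ p) {e : ℝ} (he : e = 1 / 2000)
    (h4 : 4 ≤ (p : ℝ) ^ e) (hL : 4 * (Nat.log 2 p + 1) < (p : ℝ) ^ (2 * e))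
    {J m : ℕ} (hJ0 : 0 < J) (hJ : 2 ^ J ≤ p) (hJ' : p ≤ 2 ^ (2 ^ J - 1))
    (hJe : 84 * (2 : ℝ) ^ J ≤ (p : ℝ) ^ e) (hm : 0 < m)
    {A : Finset (ZMod p)} (hA : A.Nonempty) {K : ℝ} (hK1 : 1 ≤ K)
    (hK : (#(A + A) : ℝ) ≤ K * #A) (hR : A + A + A - A - A ⊆ quadRes p)
    (hexp : 4 * K ^ 3 * Real.exp (-((1 / (4 * J : ℝ)) ^ 2 * m / 2)) ≤ 1 / (4 * J))
    (hKe : K ^ 17 ≤ (p : ℝ) ^ e)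
    (hloss : 2 * (2 ^ J * (K ^ 5) ^ (J ^ 2 + m * J)) ≤ (p : ℝ) ^ e) :
    (#A : ℝ) < (p : ℝ) ^ ((13 : ℝ) / 40) := by
  classical
  by_contra! hcon
  have hp0 : (0 : ℝ) < p := by exact_mod_cast (by omega : 0 < p)
  have hp1 : (1 : ℝ) ≤ p := by exact_mod_cast (by omega : 1 ≤ p)
  have hpe : 0 < (p : ℝ) ^ e := by positivity
  have hA0 : (0 : ℝ) < #A := by exact_mod_cast hA.card_pos
  obtain ⟨X, hXc, hX⟩ := exists_nsmul_mem_of_small_doubling hA hK1 hK hJ0 hm hexp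
  have hXbig : 2 * (#A : ℝ) ≤ (p : ℝ) ^ e * #X := by
    calc 2 * (#A : ℝ) ≤ 2 * (2 ^ J * (K ^ 5) ^ (J ^ 2 + m * J) * #X) := by gcongr
      _ = 2 * (2 ^ J * (K ^ 5) ^ (J ^ 2 + m * J)) * #X := by ring
      _ ≤ _ := by gcongr
  have hAe : (p : ℝ) ^ e ≤ #A :=
    (Real.rpow_le_rpow_of_exponent_le hp1 (by rw [he]; norm_num)).trans hcon
  have hX2 : (2 : ℝ) ≤ #X := by
    refine le_of_mul_le_mul_left ?_ hpe
    linarith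
  set X₀ := X.erase 0 with hX₀
  have hX₀c : (#A : ℝ) ≤ (p : ℝ) ^ e * #X₀ := by
    have h1 : #X - 1 ≤ #X₀ := Finset.pred_card_le_card_erase
    have h2 : (#X : ℝ) ≤ #X₀ + 1 := by exact_mod_cast (by omega : #X ≤ #X₀ + 1)
    have h3 : (#X : ℝ) ≤ 2 * #X₀ := by linarith
    nlinarith
  have h0 : (0 : ZMod p) ∉ X₀ := Finset.notMem_erase _ _
  have hX₀n : ∀ x ∈ X₀, ∀ y < 2 ^ J, y • x ∈ A + A - (A + A) :=
    fun x hx => hX x (Finset.mem_of_mem_erase hx)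
  obtain ⟨D, hD, hDc⟩ := exists_div_mem_of_nsmul_mem hp hJ hJ' h0 hX₀n hR
  have hsq : (Nat.sqrt p : ℝ) ≤ (p : ℝ) ^ (1 / 2 : ℝ) := by
    rw [← Real.sqrt_eq_rpow]
    exact Real.nat_sqrt_le_real_sqrt
  have hDe : (#D : ℝ) ≤ (p : ℝ) ^ (1 / 2 + e) := by
    have h1 : (#D : ℝ) ≤ 2 * (1 + 41 * (2 ^ J * Nat.sqrt p)) := by exact_mod_cast hDc
    have h2 : (1 : ℝ) ≤ 2 ^ J * (p : ℝ) ^ (1 / 2 : ℝ) :=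
      one_le_mul_of_one_le_of_one_le (one_le_pow₀ one_le_two)
        (Real.one_le_rpow hp1 (by norm_num))
    have h3 : (2 : ℝ) ^ J * Nat.sqrt p ≤ 2 ^ J * (p : ℝ) ^ (1 / 2 : ℝ) := by gcongr
    calc (#D : ℝ) ≤ 84 * 2 ^ J * (p : ℝ) ^ (1 / 2 : ℝ) := by linarith
      _ ≤ (p : ℝ) ^ e * (p : ℝ) ^ (1 / 2 : ℝ) := by gcongr
      _ = _ := by rw [← Real.rpow_add hp0, add_comm]
  have hAD : (#A : ℝ) ≤ #D := by
    have hX₀ne : X₀.Nonempty := by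
      rw [← Finset.card_pos]
      by_contra! h
      rw [Nat.le_zero.1 h] at hX₀c
      push_cast at hX₀c
      linarith
    obtain ⟨x, hx⟩ := hX₀ne
    have hx0 : x ≠ 0 := fun h => h0 (h ▸ hx)
    exact_mod_cast Finset.card_le_card_of_injOn (· / x) (fun a ha => hD a ha x hx)
      fun a _ b _ h => (div_left_inj' hx0).1 h
  obtain ⟨κ, hκ, hU⟩ := exists_isApproxGroup_of_small_doubling hA hK
  set U := 4 • A - 4 • A with hUdef
  have hUle : (#U : ℝ) ≤ K ^ 8 * #A := card_nsmul_sub_nsmul_le hA hK 4 4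
  have hAU : (#A : ℝ) ≤ #U := by
    exact_mod_cast card_le_card_four_nsmul_sub hA
  have hXU : X₀ - X₀ ⊆ U := by
    rw [hUdef, ← two_add_two_sub_sub]
    have hX1 : X₀ ⊆ A + A - (A + A) := fun x hx => by
      simpa using hX₀n x hx 1 (Nat.one_lt_two_pow hJ0.ne')
    exact Finset.sub_subset_sub hX1 hX1
  have hK8 : K ^ 8 ≤ (p : ℝ) ^ e := (pow_le_pow_right₀ hK1 (by norm_num)).trans hKe
  have hK16 : K ^ 16 ≤ (p : ℝ) ^ e := (pow_le_pow_right₀ hK1 (by norm_num)).trans hKe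
  have hu' : (#U : ℝ) ≤ (p : ℝ) ^ (1 / 2 + 2 * e) := by
    calc (#U : ℝ) ≤ K ^ 8 * #A := hUle
      _ ≤ (p : ℝ) ^ e * (p : ℝ) ^ (1 / 2 + e) := by
          gcongr
          exact hAD.trans hDe
      _ = _ := by rw [← Real.rpow_add hp0]; ring_nf
  have hlt := hU.card_mul_card_lt he h4 hL (hκ.trans hKe) (hcon.trans hAU) hu' h0
    (sub_subset_four_nsmul_sub hA) hXU hD hDe
  have h1 : (#U : ℝ) ^ 2 * (p : ℝ) ^ (-4 * e) ≤ (#A : ℝ) ^ 2 * (p : ℝ) ^ (-e) := by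
    calc (#U : ℝ) ^ 2 * (p : ℝ) ^ (-4 * e) ≤ (K ^ 8 * #A) ^ 2 * (p : ℝ) ^ (-4 * e) := by gcongr
      _ = K ^ 16 * #A ^ 2 * (p : ℝ) ^ (-4 * e) := by ring
      _ ≤ (p : ℝ) ^ e * #A ^ 2 * (p : ℝ) ^ (-4 * e) := by gcongr
      _ = (#A : ℝ) ^ 2 * (p : ℝ) ^ (-3 * e) := by
          rw [mul_comm ((p : ℝ) ^ e), mul_assoc, ← Real.rpow_add hp0]; ring_nf
      _ ≤ _ := by
          gcongr
          rw [he]; norm_num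
  have h2 : (#A : ℝ) * (p : ℝ) ^ (-e) ≤ #X₀ := by
    rw [Real.rpow_neg hp0.le, ← div_eq_mul_inv, div_le_iff₀ hpe, mul_comm]
    exact hX₀c
  nlinarith

end QuadraticResidues

section Parameters

lemma eventually_polylog_bounds : ∃ L₀ : ℝ, ∀ L : ℝ, L₀ ≤ L → 10 ≤ L ∧ 2 ≤ Real.logb 2 L ∧
    30000 * Real.logb 2 L ^ 5 ≤ L / 4000 ∧ 336 * L ≤ Real.exp (Real.log 2 / 2000 * L) := by
  have hlog : 0 < Real.log 2 := Real.log_pos one_lt_two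
  have h1 := (Real.isLittleO_pow_log_id_atTop (n := 5)).bound
    (show (0 : ℝ) < Real.log 2 ^ 5 / 120000000 by positivity)
  have h2 := (isLittleO_pow_exp_pos_mul_atTop 1 (show 0 < Real.log 2 / 2000 by positivity)).bound
    (show (0 : ℝ) < 1 / 336 by norm_num)
  obtain ⟨L₀, h⟩ := Filter.eventually_atTop.1
    ((h1.and h2).and (Filter.eventually_ge_atTop (10 : ℝ)))
  refine ⟨L₀, fun L hL => ?_⟩
  obtain ⟨⟨h1, h2⟩, h3⟩ := h L hL
  have hL0 : 0 < L := by linarith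
  have hlogL : 0 ≤ Real.log L := Real.log_nonneg (by linarith)
  refine ⟨h3, ?_, ?_, ?_⟩
  · rw [Real.le_logb_iff_rpow_le one_lt_two hL0]
    norm_num
    linarith
  · rw [id, Real.norm_of_nonneg (by positivity), Real.norm_of_nonneg hL0.le] at h1
    rw [Real.logb, div_pow, mul_div_assoc', div_le_iff₀ (by positivity)]
    linarith
  · rw [pow_one, Real.norm_of_nonneg hL0.le, Real.norm_of_nonneg (Real.exp_pos _).le] at h2
    linarith

lemma exists_sample_size {J : ℕ} (hJ : 0 < J) {K : ℝ} (hK : 1 ≤ K) :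
    ∃ m : ℕ, 0 < m ∧ (m : ℝ) ≤ 32 * J ^ 2 * (5 * J + 3 * Real.logb 2 K) ∧
      4 * K ^ 3 * Real.exp (-((1 / (4 * J : ℝ)) ^ 2 * m / 2)) ≤ 1 / (4 * J) := by
  have hJ1 : (1 : ℝ) ≤ J := by exact_mod_cast hJ
  have hJ2 : (1 : ℝ) ≤ (J : ℝ) ^ 2 := one_le_pow₀ hJ1
  have hK0 : 0 < K := by linarith
  set k := Real.logb 2 K with hk
  have hk0 : 0 ≤ k := Real.logb_nonneg one_lt_two hK
  set y : ℝ := 32 * J ^ 2 * (3 + J + 3 * k) with hy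
  have hy0 : 0 < y := by positivity
  refine ⟨⌈y⌉₊, Nat.ceil_pos.2 hy0, ?_, ?_⟩
  · have := (Nat.ceil_lt_add_one hy0.le).le
    rw [hy] at this ⊢
    nlinarith
  · have hexp : 4 * K ^ 3 * (4 * J) ≤ Real.exp (3 + J + 3 * k) := by
      have h16 : (16 : ℝ) ≤ Real.exp 3 := by
        have := Real.exp_one_gt_d9
        rw [show (3 : ℝ) = (3 : ℕ) * 1 by norm_num, Real.exp_nat_mul]
        calc (16 : ℝ) ≤ (2.7182818283 : ℝ) ^ 3 := by norm_num
          _ ≤ _ := by gcongr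
      have hJe : (J : ℝ) ≤ Real.exp J := by linarith [Real.add_one_le_exp (J : ℝ)]
      have hKe : K ≤ Real.exp k := by
        have : Real.log K ≤ k := by
          rw [hk, Real.logb, le_div_iff₀ (Real.log_pos one_lt_two)]
          have := Real.log_two_lt_d9
          have := Real.log_nonneg hK
          nlinarith
        calc K = Real.exp (Real.log K) := (Real.exp_log hK0).symm
          _ ≤ _ := Real.exp_le_exp.2 this
      have hKe3 : K ^ 3 ≤ Real.exp (3 * k) := by
        rw [show 3 * k = (3 : ℕ) * k by norm_num, Real.exp_nat_mul]
        gcongr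
      rw [Real.exp_add, Real.exp_add]
      calc 4 * K ^ 3 * (4 * J) = 16 * J * K ^ 3 := by ring
        _ ≤ _ := by gcongr
    have hle : 3 + J + 3 * k ≤ (1 / (4 * J : ℝ)) ^ 2 * ⌈y⌉₊ / 2 := by
      have h1 : 3 + J + 3 * k = (1 / (4 * J : ℝ)) ^ 2 * y / 2 := by
        rw [hy]; field_simp; norm_num
      rw [h1]
      gcongr
      exact Nat.le_ceil y
    rw [Real.exp_neg, ← div_eq_mul_inv, div_le_div_iff₀ (Real.exp_pos _) (by positivity), one_mul]
    exact hexp.trans (Real.exp_le_exp.2 hle)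

lemma loss_exponent_le {J k ℓ m : ℝ} (hk : 0 ≤ k) (hJ : 1 ≤ J) (hℓ : 2 ≤ ℓ) (hJℓ : J ≤ ℓ + 2)
    (hm : m ≤ 32 * J ^ 2 * (5 * J + 3 * k)) :
    1 + J + 5 * k * (J ^ 2 + m * J) ≤ 30000 * ℓ ^ 5 + 10280 * (k ^ 2 * ℓ ^ 3) := by
  have hJ2 : J ≤ 2 * ℓ := by linarith
  have hJ0 : 0 ≤ J := by linarith
  have h3 : J ^ 3 ≤ 8 * ℓ ^ 3 := by
    calc J ^ 3 ≤ (2 * ℓ) ^ 3 := by gcongr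
      _ = _ := by ring
  have h5 : J ^ 5 ≤ 32 * ℓ ^ 5 := by
    calc J ^ 5 ≤ (2 * ℓ) ^ 5 := by gcongr
      _ = _ := by ring
  have hℓ5 : ℓ ≤ ℓ ^ 5 := le_self_pow₀ (by linarith) (by norm_num)
  have hmJ : m * J ≤ 32 * J ^ 2 * (5 * J + 3 * k) * J := by gcongr
  have hJ24 : J ^ 2 ≤ J ^ 4 := pow_le_pow_right₀ hJ (by norm_num)
  have hkJ : k * J ^ 4 ≤ J ^ 3 * k ^ 2 + J ^ 5 := by
    have : k * J ≤ k ^ 2 + J ^ 2 := by nlinarith [sq_nonneg (k - J), sq_nonneg k, sq_nonneg J]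
    calc k * J ^ 4 = J ^ 3 * (k * J) := by ring
      _ ≤ J ^ 3 * (k ^ 2 + J ^ 2) := by gcongr
      _ = _ := by ring
  have hkJ3 : J ^ 3 * k ^ 2 ≤ 8 * ℓ ^ 3 * k ^ 2 := by gcongr
  calc 1 + J + 5 * k * (J ^ 2 + m * J)
      ≤ 1 + J + 5 * k * (J ^ 4 + 32 * J ^ 2 * (5 * J + 3 * k) * J) := by gcongr
    _ = 1 + J + 805 * (k * J ^ 4) + 480 * (J ^ 3 * k ^ 2) := by ring
    _ ≤ _ := by linarith

end Parameters

section LargePrimes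

variable {p : ℕ} [Fact p.Prime]

lemma card_lt_of_log_sq_mul_le {L₀ : ℝ} (hL₀ : ∀ L : ℝ, L₀ ≤ L → 10 ≤ L ∧ 2 ≤ Real.logb 2 L ∧
      30000 * Real.logb 2 L ^ 5 ≤ L / 4000 ∧ 336 * L ≤ Real.exp (Real.log 2 / 2000 * L))
    (hp : L₀ ≤ Real.logb 2 p) {A : Finset (ZMod p)} (hA : A.Nonempty) {K : ℝ} (hK1 : 1 ≤ K)
    (hK : (#(A + A) : ℝ) ≤ K * #A) (hR : A + A + A - A - A ⊆ quadRes p)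
    (hKp : 50000000 * (Real.logb 2 K ^ 2 * Real.logb 2 (Real.logb 2 p) ^ 3) ≤ Real.logb 2 p) :
    (#A : ℝ) < (p : ℝ) ^ ((13 : ℝ) / 40) := by
  have hp0 : (0 : ℝ) < p := by exact_mod_cast (Fact.out : p.Prime).pos
  have hp1 : (1 : ℝ) ≤ p := by exact_mod_cast (Fact.out : p.Prime).one_lt.le
  have hK0 : 0 < K := by linarith
  obtain ⟨hL10, hℓ2, hℓ5, hLe⟩ := hL₀ _ hp
  set L := Real.logb 2 p with hL
  set ℓ := Real.logb 2 L with hℓ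
  set k := Real.logb 2 K with hk
  have hk0 : 0 ≤ k := Real.logb_nonneg one_lt_two hK1
  have hpL : (2 : ℝ) ^ L = p := Real.rpow_logb two_pos (by norm_num) hp0
  have hLℓ : (2 : ℝ) ^ ℓ = L := Real.rpow_logb two_pos (by norm_num) (by linarith)
  have hKk : (2 : ℝ) ^ k = K := Real.rpow_logb two_pos (by norm_num) hK0
  obtain ⟨e, he⟩ : ∃ e : ℝ, e = 1 / 2000 := ⟨_, rfl⟩
  have hpe : (p : ℝ) ^ e = (2 : ℝ) ^ (L / 2000) := by
    rw [← hpL, ← Real.rpow_mul two_pos.le, he]; ring_nf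
  have hpe' : 336 * L ≤ (p : ℝ) ^ e := by
    rw [hpe, Real.rpow_def_of_pos two_pos]
    convert hLe using 2
    ring
  have hpe1 : 1 ≤ (p : ℝ) ^ e := by linarith
  have hpep : (p : ℝ) ^ e ≤ p := by
    calc (p : ℝ) ^ e ≤ (p : ℝ) ^ (1 : ℝ) :=
          Real.rpow_le_rpow_of_exponent_le hp1 (by rw [he]; norm_num)
      _ = p := Real.rpow_one _
  set J := ⌈ℓ⌉₊ + 1 with hJ
  have hJℓ : (J : ℝ) ≤ ℓ + 2 := by
    have := (Nat.ceil_lt_add_one (show 0 ≤ ℓ by linarith)).le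
    rw [hJ]; push_cast; linarith
  have hℓJ : ℓ + 1 ≤ J := by
    have := Nat.le_ceil ℓ
    rw [hJ]; push_cast; linarith
  have h2J : (2 : ℝ) ^ J ≤ 4 * L := by
    rw [← Real.rpow_natCast]
    calc (2 : ℝ) ^ (J : ℝ) ≤ 2 ^ (ℓ + 2) := Real.rpow_le_rpow_of_exponent_le one_le_two hJℓ
      _ = 4 * L := by rw [Real.rpow_add two_pos, hLℓ]; norm_num; ring
  have h2J' : 2 * L ≤ (2 : ℝ) ^ J := by
    rw [← Real.rpow_natCast]
    calc 2 * L = (2 : ℝ) ^ (ℓ + 1) := by rw [Real.rpow_add two_pos, hLℓ]; norm_num; ring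
      _ ≤ _ := Real.rpow_le_rpow_of_exponent_le one_le_two hℓJ
  have hJp : p ≤ 2 ^ (2 ^ J - 1) := by
    have h1 : L ≤ ((2 ^ J - 1 : ℕ) : ℝ) := by
      rw [Nat.cast_sub Nat.one_le_two_pow]
      push_cast
      linarith
    have h2 : (p : ℝ) ≤ 2 ^ (2 ^ J - 1) := by
      rw [← Real.rpow_natCast]
      calc (p : ℝ) = 2 ^ L := hpL.symm
        _ ≤ _ := Real.rpow_le_rpow_of_exponent_le one_le_two h1
    exact_mod_cast h2
  obtain ⟨m, hm, hmle, hexp⟩ := exists_sample_size (J := J) (Nat.succ_pos _) hK1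
  have hJ1 : (3 : ℝ) ≤ J := by linarith
  have hloss : 2 * (2 ^ J * (K ^ 5) ^ (J ^ 2 + m * J)) ≤ (p : ℝ) ^ e := by
    have h1 := loss_exponent_le hk0 (by linarith) hℓ2 hJℓ hmle
    have h2 : 2 * (2 ^ J * (K ^ 5) ^ (J ^ 2 + m * J)) =
        (2 : ℝ) ^ (1 + J + 5 * k * ((J : ℝ) ^ 2 + m * J)) := by
      rw [Real.rpow_add two_pos, Real.rpow_add two_pos, Real.rpow_one, Real.rpow_natCast,
        show 5 * k * ((J : ℝ) ^ 2 + m * J) = k * ((5 * (J ^ 2 + m * J) : ℕ) : ℝ) by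
          push_cast; ring,
        Real.rpow_mul two_pos.le, hKk, Real.rpow_natCast, ← pow_mul, mul_assoc]
    rw [h2, hpe]
    refine Real.rpow_le_rpow_of_exponent_le one_le_two ?_
    linarith
  have hKe : K ^ 17 ≤ (p : ℝ) ^ e := by
    have hJ3 : 3 ≤ J := by exact_mod_cast hJ1
    have h1 : K ^ 17 ≤ (K ^ 5) ^ (J ^ 2 + m * J) := by
      rw [← pow_mul]
      exact pow_le_pow_right₀ hK1 (by nlinarith)
    have h2 : (1 : ℝ) ≤ 2 ^ J := one_le_pow₀ one_le_two
    have h3 : 0 ≤ (K ^ 5) ^ (J ^ 2 + m * J) := by positivity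
    nlinarith
  have hlog : (Nat.log 2 p : ℝ) ≤ L := by
    have := Real.natLog_le_logb p 2
    exact_mod_cast this
  refine card_lt_of_small_loss (J := J) ?_ he ?_ ?_ (Nat.succ_pos _) ?_ hJp ?_ hm hA hK1 hK hR hexp hKe
    hloss
  · have : (1000 : ℝ) ≤ p := by linarith
    exact_mod_cast this
  · linarith
  · calc 4 * ((Nat.log 2 p : ℝ) + 1) < (p : ℝ) ^ e := by linarith
      _ ≤ _ := Real.rpow_le_rpow_of_exponent_le hp1 (by rw [he]; norm_num)
  · have : (2 : ℝ) ^ J ≤ p := by linarith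
    exact_mod_cast this
  · linarith

end LargePrimes

theorem stmt12 :
    ∃ C : ℝ, 0 < C ∧
      ∀ (p : ℕ) [Fact p.Prime],
        0 < Real.logb 2 (Real.logb 2 p) →
        ∀ (A : Finset (ZMod p)) (K : ℝ),
          A.Nonempty → 1 ≤ K →
          ((A + A).card : ℝ) ≤ K * A.card →
          A + A + A - A - A ⊆ quadRes p →
          (A.card : ℝ) ≤ C * (p : ℝ) ^ ((13 : ℝ) / 40) *
            Real.exp (C * (Real.logb 2 K) ^ 2 * (Real.logb 2 (Real.logb 2 p)) ^ 3) := by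
  obtain ⟨L₀, hL₀⟩ := eventually_polylog_bounds
  set C : ℝ := 50000000 + 2 ^ L₀ with hC
  have h2L : (0 : ℝ) < 2 ^ L₀ := by positivity
  refine ⟨C, by positivity, ?_⟩
  intro p _ hℓ A K hA hK1 hK hR
  have hp0 : (0 : ℝ) < p := by exact_mod_cast (Fact.out : p.Prime).pos
  have hp1 : (1 : ℝ) ≤ p := by exact_mod_cast (Fact.out : p.Prime).one_lt.le
  have hpL : (2 : ℝ) ^ Real.logb 2 p = p := Real.rpow_logb two_pos (by norm_num) hp0
  set w := Real.logb 2 K ^ 2 * Real.logb 2 (Real.logb 2 p) ^ 3 with hw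
  have hw0 : 0 ≤ w := by positivity
  rw [mul_assoc C (Real.logb 2 K ^ 2), ← hw]
  have hAp : (#A : ℝ) ≤ p := by
    have := Finset.card_le_univ A
    rw [ZMod.card] at this
    exact_mod_cast this
  have hpow : 1 ≤ (p : ℝ) ^ ((13 : ℝ) / 40) := Real.one_le_rpow hp1 (by norm_num)
  have hE : 1 ≤ Real.exp (C * w) := Real.one_le_exp (by positivity)
  have hC1 : 1 ≤ C := by linarith
  rcases lt_or_ge (Real.logb 2 p) L₀ with hsmall | hbig
  · have hpC : (p : ℝ) ≤ C := by
      rw [← hpL, hC]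
      linarith [Real.rpow_le_rpow_of_exponent_le one_le_two hsmall.le]
    calc (#A : ℝ) ≤ C := hAp.trans hpC
      _ = C * 1 * 1 := by ring
      _ ≤ _ := by gcongr
  rcases le_or_gt (50000000 * w) (Real.logb 2 p) with hKp | hKp
  · calc (#A : ℝ) ≤ (p : ℝ) ^ ((13 : ℝ) / 40) :=
          (card_lt_of_log_sq_mul_le hL₀ hbig hA hK1 hK hR hKp).le
      _ = 1 * (p : ℝ) ^ ((13 : ℝ) / 40) * 1 := by ring
      _ ≤ _ := by gcongr
  · have hpE : (p : ℝ) ≤ Real.exp (C * w) := by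
      have h1 : Real.log p ≤ Real.logb 2 p := by
        rw [Real.logb, le_div_iff₀ (Real.log_pos one_lt_two)]
        nlinarith [Real.log_two_lt_d9, Real.log_nonneg hp1]
      have h2 : 50000000 * w ≤ C * w := by gcongr; linarith
      rw [← Real.exp_log hp0]
      exact Real.exp_le_exp.2 (by linarith)
    calc (#A : ℝ) ≤ Real.exp (C * w) := hAp.trans hpE
      _ = 1 * 1 * Real.exp (C * w) := by ring
      _ ≤ _ := by gcongr
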